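/- arXiv:0804.3855 — 3 statements merged into one kernel-verified Lean document; each statement's English description precedes it below -/
import Mathlib

section
/- Let k : 𝔻∖{0} → ℝ be a bounded, nonpositive, continuous function and let λ : 𝔻∖{0} → (0,∞) be a C² function such that the conformal metric λ(z)|dz| has curvature −k(z) on 𝔻∖{0} (i.e. Δ(log λ)(z) = k(z)·λ(z)² for all z ∈ 𝔻∖{0}) and ∬_𝔻 λ(z)² dxdy < ∞. Let γ > −1 be the order of the conical singularity of λ(z)|dz| at z = 0, i.e. the real number with log λ(z) = γ·log|z| + r(z) for a function r continuous on 𝔻. Then lim_{z→0} z·Γ_λ(z) = γ, where Γ_λ(z) = 2·∂(log λ)/∂z (z) is the connection of λ(z)|dz|. -/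
open Metric MeasureTheory Filter
open scoped ENNReal Topology

/-- The Laplacian Δu = ∂²u/∂x² + ∂²u/∂y² of a function on ℂ ≅ ℝ². -/
noncomputable def lapl (u : ℂ → ℝ) (z : ℂ) : ℝ :=
  fderiv ℝ (fun w => fderiv ℝ u w 1) z 1
    + fderiv ℝ (fun w => fderiv ℝ u w Complex.I) z Complex.I

/-- The Wirtinger derivative ∂u/∂z = (∂u/∂x − i·∂u/∂y)/2 of a real-valued function. -/
noncomputable def wirtR (u : ℂ → ℝ) (z : ℂ) : ℂ :=
  ((fderiv ℝ u z 1 : ℝ) - Complex.I * (fderiv ℝ u z Complex.I : ℝ)) / 2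

/-- The Wirtinger derivative ∂f/∂z = (∂f/∂x − i·∂f/∂y)/2 of a complex-valued function. -/
noncomputable def wirtC (f : ℂ → ℂ) (z : ℂ) : ℂ :=
  (fderiv ℝ f z 1 - Complex.I * fderiv ℝ f z Complex.I) / 2

/-- The connection Γ_λ = 2·∂(log λ)/∂z of the conformal metric λ(z)|dz|. -/
noncomputable def conn (lam : ℂ → ℝ) (z : ℂ) : ℂ :=
  2 * wirtR (fun w => Real.log (lam w)) z

/-- The Schwarzian S_λ = ∂Γ_λ/∂z − Γ_λ²/2 of the conformal metric λ(z)|dz|. -/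
noncomputable def schw (lam : ℂ → ℝ) (z : ℂ) : ℂ :=
  wirtC (conn lam) z - (conn lam z) ^ 2 / 2

/-- Necessary second-order condition at a local maximum of a function of one real variable. -/
theorem IsLocalMax.second_deriv_nonpos {g g' : ℝ → ℝ} {p c : ℝ} (hmax : IsLocalMax g p)
    (hg : ∀ᶠ s in 𝓝 p, HasDerivAt g (g' s) s) (hg' : HasDerivAt g' c p) : c ≤ 0 := by
  by_contra! hc
  have hd : deriv g =ᶠ[𝓝 p] g' := hg.mono fun s hs => hs.deriv
  have h2 : deriv (deriv g) p = c := by rw [hd.deriv_eq, hg'.deriv]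
  have hmin : IsLocalMin g p :=
    isLocalMin_of_deriv_deriv_pos (by rwa [h2]) hmax.deriv_eq_zero
      hg.self_of_nhds.continuousAt
  have hconst : g =ᶠ[𝓝 p] fun _ => g p := by
    filter_upwards [hmax, hmin] with s h1 h2 using le_antisymm h1 h2
  have h0 : deriv (deriv g) p = 0 := by
    rw [hconst.deriv.deriv_eq]; simp
  linarith

theorem HasDerivAt.comp_neg_real {g : ℝ → ℝ} {g' s : ℝ} (h : HasDerivAt g g' (-s)) :
    HasDerivAt (fun t => g (-t)) (-g') s :=
  (h.comp s (hasDerivAt_neg s)).congr_deriv (by ring)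

theorem hasDerivAt_mul_const_sub (e s : ℝ) : HasDerivAt (fun t : ℝ => t * (e - t)) (e - 2 * s) s :=
  ((hasDerivAt_id s).mul ((hasDerivAt_id s).const_sub e)).congr_deriv (by simp; ring)

/-- One-sided comparison estimate for the derivative at the centre of a square of a function with
bounded Laplacian, obtained from the maximum principle on the upper half of the square. -/
theorem partial_deriv_le_of_laplacian_bound {f fx fxx fy fyy : ℝ → ℝ → ℝ} {d M K : ℝ} (hd : 0 < d)
    (hcont : ContinuousOn (fun p : ℝ × ℝ => f p.1 p.2) (Set.Icc (-d) d ×ˢ Set.Icc (-d) d))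
    (hfx : ∀ x ∈ Set.Icc (-d) d, ∀ y ∈ Set.Icc (-d) d, HasDerivAt (fun s => f s y) (fx x y) x)
    (hfxx : ∀ x ∈ Set.Icc (-d) d, ∀ y ∈ Set.Icc (-d) d, HasDerivAt (fun s => fx s y) (fxx x y) x)
    (hfy : ∀ x ∈ Set.Icc (-d) d, ∀ y ∈ Set.Icc (-d) d, HasDerivAt (fun s => f x s) (fy x y) y)
    (hfyy : ∀ x ∈ Set.Icc (-d) d, ∀ y ∈ Set.Icc (-d) d, HasDerivAt (fun s => fy x s) (fyy x y) y)
    (hM : ∀ x ∈ Set.Icc (-d) d, ∀ y ∈ Set.Icc (-d) d, |f x y| ≤ M)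
    (hK : ∀ x ∈ Set.Icc (-d) d, ∀ y ∈ Set.Icc (-d) d, |fxx x y + fyy x y| < K) :
    fy 0 0 ≤ 2 * M / d + K * d / 2 := by
  have h0 : (0 : ℝ) ∈ Set.Icc (-d) d := ⟨by linarith, hd.le⟩
  have hM0 : 0 ≤ M := (abs_nonneg _).trans (hM 0 h0 0 h0)
  have hK0 : 0 < K := (abs_nonneg _).trans_lt (hK 0 h0 0 h0)
  obtain ⟨A, rfl⟩ : ∃ A, M = A * d ^ 2 := ⟨M / d ^ 2, by field_simp⟩
  have hA : 0 ≤ A := nonneg_of_mul_nonneg_left hM0 (by positivity)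
  have hneg : ∀ {y}, y ∈ Set.Icc (-d) d → -y ∈ Set.Icc (-d) d := fun hy =>
    ⟨by linarith [hy.2], by linarith [hy.1]⟩
  have hsub : ∀ {y}, y ∈ Set.Icc 0 d → y ∈ Set.Icc (-d) d := fun hy => ⟨by linarith [hy.1], hy.2⟩
  let w : ℝ → ℝ → ℝ := fun x y =>
    (f x y - f x (-y)) / 2 - (A * (x ^ 2 + y * (2 * d - y)) + K / 2 * (y * (d - y)))
  have hwle : ∀ x ∈ Set.Icc (-d) d, ∀ y ∈ Set.Icc 0 d, w x y ≤ 0 := by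
    have hwc : ContinuousOn (fun p : ℝ × ℝ => w p.1 p.2) (Set.Icc (-d) d ×ˢ Set.Icc 0 d) := by
      have h1 : ContinuousOn (fun p : ℝ × ℝ => f p.1 p.2) (Set.Icc (-d) d ×ˢ Set.Icc 0 d) :=
        hcont.mono (Set.prod_mono subset_rfl fun y hy => hsub hy)
      have h2 : ContinuousOn (fun p : ℝ × ℝ => f p.1 (-p.2)) (Set.Icc (-d) d ×ˢ Set.Icc 0 d) :=
        hcont.comp (f := fun p : ℝ × ℝ => (p.1, -p.2)) (by fun_prop)
          fun p hp => ⟨hp.1, hneg (hsub hp.2)⟩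
      exact ((h1.sub h2).div_const 2).sub (by fun_prop)
    obtain ⟨⟨a, b⟩, ⟨ha, hb⟩, hmax⟩ := (isCompact_Icc.prod isCompact_Icc).exists_isMaxOn
      ⟨((0 : ℝ), (0 : ℝ)), h0, Set.left_mem_Icc.2 hd.le⟩ hwc
    simp only at ha hb
    suffices hab : w a b ≤ 0 from fun x hx y hy =>
      (hmax (show (x, y) ∈ Set.Icc (-d) d ×ˢ Set.Icc 0 d from ⟨hx, hy⟩)).trans hab
    have hb' := hsub hb
    have hphi : (f a b - f a (-b)) / 2 ≤ A * d ^ 2 := by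
      have h1 := abs_le.1 (hM a ha b hb')
      have h2 := abs_le.1 (hM a ha (-b) (hneg hb'))
      linarith [h1.2, h2.1]
    have hbd : 0 ≤ b * (d - b) := mul_nonneg hb.1 (by linarith [hb.2])
    have hb2d : 0 ≤ b * (2 * d - b) := mul_nonneg hb.1 (by linarith [hb.2])
    have hKbd : 0 ≤ K / 2 * (b * (d - b)) := mul_nonneg (by linarith) hbd
    rcases eq_or_lt_of_le hb.1 with rfl | hb0
    · have : 0 ≤ A * a ^ 2 := by positivity
      simp only [w]; simp; linarith
    rcases eq_or_lt_of_le hb.2 with rfl | hbd'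
    · have : 0 ≤ A * a ^ 2 := by positivity
      simp only [w]; nlinarith
    have hside : a ^ 2 = d ^ 2 → w a b ≤ 0 := fun h => by
      have := mul_nonneg hA hb2d
      simp only [w]; rw [h]; nlinarith
    rcases eq_or_lt_of_le ha.1 with h | ha1
    · exact hside (by rw [← h]; ring)
    rcases eq_or_lt_of_le ha.2 with h | ha2
    · exact hside (by rw [h])
    exfalso
    have hx : IsLocalMax (fun s => w s b) a := by
      filter_upwards [Ioo_mem_nhds ha1 ha2] with s hs
      exact hmax (show (s, b) ∈ Set.Icc (-d) d ×ˢ Set.Icc 0 d from ⟨Set.Ioo_subset_Icc_self hs, hb⟩)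
    have hy : IsLocalMax (fun s => w a s) b := by
      filter_upwards [Ioo_mem_nhds hb0 hbd'] with s hs
      exact hmax (show (a, s) ∈ Set.Icc (-d) d ×ˢ Set.Icc 0 d from ⟨ha, Set.Ioo_subset_Icc_self hs⟩)
    have hxx := hx.second_deriv_nonpos
      (g' := fun s => (fx s b - fx s (-b)) / 2 - A * (2 * s))
      (c := (fxx a b - fxx a (-b)) / 2 - A * 2)
      (by
        filter_upwards [Ioo_mem_nhds ha1 ha2] with s hs
        have hs := Set.Ioo_subset_Icc_self hs
        have hq : HasDerivAt (fun s : ℝ => A * (s ^ 2 + b * (2 * d - b)) + K / 2 * (b * (d - b)))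
            (A * (2 * s)) s := by
          simpa using ((((hasDerivAt_id s).pow 2).add_const (b * (2 * d - b))).const_mul
            A).add_const (K / 2 * (b * (d - b)))
        exact (((hfx s hs b hb').sub (hfx s hs (-b) (hneg hb'))).div_const 2).sub hq)
      ((((hfxx a ha b hb').sub (hfxx a ha (-b) (hneg hb'))).div_const 2).sub
        (by simpa using ((hasDerivAt_id a).const_mul 2).const_mul A))
    have hyy := hy.second_deriv_nonpos
      (g' := fun s => (fy a s + fy a (-s)) / 2 - (A * (2 * d - 2 * s) + K / 2 * (d - 2 * s)))
      (c := (fyy a b - fyy a (-b)) / 2 - (A * (-2) + K / 2 * (-2)))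
      (by
        filter_upwards [Ioo_mem_nhds hb0 hbd'] with s hs
        have hs := hsub (Set.Ioo_subset_Icc_self hs)
        have h := (((hfy a ha s hs).sub (hfy a ha (-s) (hneg hs)).comp_neg_real).div_const 2).sub
          ((((hasDerivAt_mul_const_sub (2 * d) s).const_add (a ^ 2)).const_mul A).add
            ((hasDerivAt_mul_const_sub d s).const_mul (K / 2)))
        exact h.congr_deriv (by ring))
      (by
        have hq : ∀ e : ℝ, HasDerivAt (fun s : ℝ => e - 2 * s) (-2) b := fun e => by
          simpa using ((hasDerivAt_id b).const_mul 2).const_sub e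
        have h := (((hfyy a ha b hb').add
          (hfyy a ha (-b) (hneg hb')).comp_neg_real).div_const 2).sub
          (((hq (2 * d)).const_mul A).add ((hq d).const_mul (K / 2)))
        exact h.congr_deriv (by ring))
    have h1 := abs_lt.1 (hK a ha b hb')
    have h2 := abs_lt.1 (hK a ha (-b) (hneg hb'))
    linarith [h1.1, h2.2]
  have hw0 : w 0 0 = 0 := by simp [w]
  have hwd : HasDerivAt (w 0) (fy 0 0 - (A * (2 * d) + K / 2 * d)) 0 := by
    have hn : HasDerivAt (fun t => f 0 (-t)) (-fy 0 0) 0 := by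
      have : HasDerivAt (fun s => f 0 s) (fy 0 0) (-0) := by simpa using hfy 0 h0 0 h0
      exact this.comp_neg_real
    have h := (((hfy 0 h0 0 h0).sub hn).div_const 2).sub
      ((((hasDerivAt_mul_const_sub (2 * d) 0).const_add (0 ^ 2)).const_mul A).add
        ((hasDerivAt_mul_const_sub d 0).const_mul (K / 2)))
    exact h.congr_deriv (by ring)
  have hslope := (hasDerivAt_iff_tendsto_slope.1 hwd).mono_left
    (nhdsWithin_mono (0 : ℝ) (fun s (hs : s ∈ Set.Ioi 0) => (ne_of_gt hs : s ≠ 0)))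
  have hle : fy 0 0 - (A * (2 * d) + K / 2 * d) ≤ 0 := by
    refine le_of_tendsto hslope ?_
    filter_upwards [Ioo_mem_nhdsGT hd] with s hs
    rw [slope_def_field, hw0, sub_zero, sub_zero]
    exact div_nonpos_of_nonpos_of_nonneg (hwle 0 h0 s (Set.Ioo_subset_Icc_self hs)) hs.1.le
  have : 2 * (A * d ^ 2) / d = A * (2 * d) := by field_simp
  linarith

/-- Interior gradient estimate: the derivative at the centre of a square is controlled by the
supremum of the function and of its Laplacian. -/
theorem abs_partial_deriv_le_of_laplacian_bound {f fx fxx fy fyy : ℝ → ℝ → ℝ} {d M K : ℝ}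
    (hd : 0 < d)
    (hcont : ContinuousOn (fun p : ℝ × ℝ => f p.1 p.2) (Set.Icc (-d) d ×ˢ Set.Icc (-d) d))
    (hfx : ∀ x ∈ Set.Icc (-d) d, ∀ y ∈ Set.Icc (-d) d, HasDerivAt (fun s => f s y) (fx x y) x)
    (hfxx : ∀ x ∈ Set.Icc (-d) d, ∀ y ∈ Set.Icc (-d) d, HasDerivAt (fun s => fx s y) (fxx x y) x)
    (hfy : ∀ x ∈ Set.Icc (-d) d, ∀ y ∈ Set.Icc (-d) d, HasDerivAt (fun s => f x s) (fy x y) y)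
    (hfyy : ∀ x ∈ Set.Icc (-d) d, ∀ y ∈ Set.Icc (-d) d, HasDerivAt (fun s => fy x s) (fyy x y) y)
    (hM : ∀ x ∈ Set.Icc (-d) d, ∀ y ∈ Set.Icc (-d) d, |f x y| ≤ M)
    (hK : ∀ x ∈ Set.Icc (-d) d, ∀ y ∈ Set.Icc (-d) d, |fxx x y + fyy x y| < K) :
    |fy 0 0| ≤ 2 * M / d + K * d / 2 := by
  refine abs_le'.2 ⟨partial_deriv_le_of_laplacian_bound hd hcont hfx hfxx hfy hfyy hM hK, ?_⟩
  refine partial_deriv_le_of_laplacian_bound (f := fun x y => -f x y) (fx := fun x y => -fx x y)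
    (fxx := fun x y => -fxx x y) (fy := fun x y => -fy x y) (fyy := fun x y => -fyy x y) hd hcont.neg
    (fun x hx y hy => (hfx x hx y hy).neg) (fun x hx y hy => (hfxx x hx y hy).neg)
    (fun x hx y hy => (hfy x hx y hy).neg) (fun x hx y hy => (hfyy x hx y hy).neg)
    (fun x hx y hy => by simpa using hM x hx y hy) (fun x hx y hy => ?_)
  rw [← neg_add, abs_neg]
  exact hK x hx y hy

theorem tendsto_norm_sq_mul_exp_log {γ : ℝ} (hγ : -1 < γ) {r : ℂ → ℝ} (hr : ContinuousAt r 0) :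
    Tendsto (fun z : ℂ => Real.exp (2 * ((γ + 1) * Real.log ‖z‖ + r z))) (𝓝[≠] 0) (𝓝 0) := by
  have hlog : Tendsto (fun z : ℂ => Real.log ‖z‖) (𝓝[≠] 0) atBot :=
    Real.tendsto_log_nhdsGT_zero.comp tendsto_norm_nhdsNE_zero
  have h1 := hlog.const_mul_atBot (show 0 < γ + 1 by linarith)
  have h2 := h1.atBot_add (hr.tendsto.mono_left nhdsWithin_le_nhds)
  exact Real.tendsto_exp_atBot.comp (h2.const_mul_atBot two_pos)

/-- First and second derivatives of `½ log (X² + c²)`, half the logarithm of the squared modulus. -/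
theorem hasDerivAt_half_log_sq_add {a c s : ℝ} (h : (a + s) ^ 2 + c ^ 2 ≠ 0) :
    HasDerivAt (fun t => Real.log ((a + t) ^ 2 + c ^ 2) / 2)
      ((a + s) / ((a + s) ^ 2 + c ^ 2)) s ∧
    HasDerivAt (fun t => (a + t) / ((a + t) ^ 2 + c ^ 2))
      ((c ^ 2 - (a + s) ^ 2) / ((a + s) ^ 2 + c ^ 2) ^ 2) s := by
  have h1 : HasDerivAt (fun t : ℝ => a + t) 1 s := (hasDerivAt_id s).const_add a
  have h2 : HasDerivAt (fun t : ℝ => (a + t) ^ 2 + c ^ 2) (2 * (a + s)) s := by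
    simpa using (h1.pow 2).add_const (c ^ 2)
  constructor
  · exact ((h2.log h).div_const 2).congr_deriv (by field_simp)
  · exact (h1.div h2 h).congr_deriv (by field_simp; ring)

/-- The gradient at `z₀` of `u - γ log |z|` is controlled by its oscillation and by the Laplacian
of `u` on a disk about `z₀` that avoids the origin. -/
theorem norm_two_wirtR_sub_le {u : ℂ → ℝ} {γ m M K : ℝ} {z₀ : ℂ} (hz₀ : z₀ ≠ 0)
    (hu : ∀ z, ‖z - z₀‖ ≤ ‖z₀‖ / 2 → ContDiffAt ℝ 2 u z)
    (hM : ∀ z, ‖z - z₀‖ ≤ ‖z₀‖ / 2 → |u z - γ * Real.log ‖z‖ - m| ≤ M)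
    (hK : ∀ z, ‖z - z₀‖ ≤ ‖z₀‖ / 2 → |lapl u z| < K) :
    ‖2 * wirtR u z₀ - γ / z₀‖ ≤ 16 * M / ‖z₀‖ + K * ‖z₀‖ / 4 := by
  have hpos : 0 < ‖z₀‖ := norm_pos_iff.2 hz₀
  set d := ‖z₀‖ / 4 with hd_def
  have hd : 0 < d := by positivity
  set a := z₀.re with ha
  set b := z₀.im with hb
  let P : ℝ → ℝ → ℂ := fun x y => z₀ + x + y * Complex.I
  have hP0 : P 0 0 = z₀ := by simp [P]
  have hnear : ∀ x ∈ Set.Icc (-d) d, ∀ y ∈ Set.Icc (-d) d, ‖P x y - z₀‖ ≤ ‖z₀‖ / 2 := by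
    intro x hx y hy
    have h1 : P x y - z₀ = x + y * Complex.I := by simp only [P]; ring
    have h2 : ‖(x : ℂ) + y * Complex.I‖ ≤ |x| + |y| := by
      refine (norm_add_le _ _).trans ?_
      simp
    rw [h1]
    linarith [abs_le.2 hx, abs_le.2 hy]
  have hPsq : ∀ x y, ‖P x y‖ ^ 2 = (a + x) ^ 2 + (b + y) ^ 2 := by
    intro x y
    rw [Complex.sq_norm, Complex.normSq_apply]
    simp [P, ha, hb]
    ring
  have hPne : ∀ x ∈ Set.Icc (-d) d, ∀ y ∈ Set.Icc (-d) d, (a + x) ^ 2 + (b + y) ^ 2 ≠ 0 := by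
    intro x hx y hy h
    rw [← hPsq] at h
    have h0 : P x y = 0 := by simpa using h
    have := hnear x hx y hy
    rw [h0, zero_sub, norm_neg] at this
    linarith
  have hPlog : ∀ x y, Real.log ‖P x y‖ = Real.log ((a + x) ^ 2 + (b + y) ^ 2) / 2 := by
    intro x y
    rw [← hPsq, Real.log_pow]
    push_cast
    ring
  have hPx : ∀ x y : ℝ, HasDerivAt (fun s => P s y) 1 x := fun x y =>
    (Complex.ofRealCLM.hasDerivAt.const_add z₀).add_const _
  have hPy : ∀ x y : ℝ, HasDerivAt (fun s => P x s) Complex.I y := fun x y =>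
    ((Complex.ofRealCLM.hasDerivAt.mul_const Complex.I).const_add (z₀ + (x : ℂ))).congr_deriv
      (by simp)
  have hu1 : ∀ z, ‖z - z₀‖ ≤ ‖z₀‖ / 2 → HasFDerivAt u (fderiv ℝ u z) z := fun z hz =>
    ((hu z hz).differentiableAt (by norm_num)).hasFDerivAt
  have hu2 : ∀ z, ‖z - z₀‖ ≤ ‖z₀‖ / 2 → ∀ e : ℂ,
      HasFDerivAt (fun w => fderiv ℝ u w e) (fderiv ℝ (fun w => fderiv ℝ u w e) z) z :=
    fun z hz e => ((((hu z hz).fderiv_right (m := 1) (by norm_num)).differentiableAt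
      (by norm_num)).clm_apply (differentiableAt_const e)).hasFDerivAt
  let f : ℝ → ℝ → ℝ := fun x y =>
    u (P x y) - γ * (Real.log ((a + x) ^ 2 + (b + y) ^ 2) / 2) - m
  let fx : ℝ → ℝ → ℝ := fun x y =>
    fderiv ℝ u (P x y) 1 - γ * ((a + x) / ((a + x) ^ 2 + (b + y) ^ 2))
  let fy : ℝ → ℝ → ℝ := fun x y =>
    fderiv ℝ u (P x y) Complex.I - γ * ((b + y) / ((b + y) ^ 2 + (a + x) ^ 2))
  let fxx : ℝ → ℝ → ℝ := fun x y => fderiv ℝ (fun w => fderiv ℝ u w 1) (P x y) 1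
    - γ * (((b + y) ^ 2 - (a + x) ^ 2) / ((a + x) ^ 2 + (b + y) ^ 2) ^ 2)
  let fyy : ℝ → ℝ → ℝ := fun x y =>
    fderiv ℝ (fun w => fderiv ℝ u w Complex.I) (P x y) Complex.I
    - γ * (((a + x) ^ 2 - (b + y) ^ 2) / ((b + y) ^ 2 + (a + x) ^ 2) ^ 2)
  have hfx : ∀ x ∈ Set.Icc (-d) d, ∀ y ∈ Set.Icc (-d) d, HasDerivAt (fun s => f s y) (fx x y) x :=
    fun x hx y hy => (((hu1 _ (hnear x hx y hy)).comp_hasDerivAt x (hPx x y)).sub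
      ((hasDerivAt_half_log_sq_add (hPne x hx y hy)).1.const_mul γ)).sub_const m
  have hfxx : ∀ x ∈ Set.Icc (-d) d, ∀ y ∈ Set.Icc (-d) d, HasDerivAt (fun s => fx s y) (fxx x y) x :=
    fun x hx y hy => (HasFDerivAt.comp_hasDerivAt (f := fun s => P s y) x
      (hu2 _ (hnear x hx y hy) 1) (hPx x y)).sub
      ((hasDerivAt_half_log_sq_add (hPne x hx y hy)).2.const_mul γ)
  have hPne' : ∀ x ∈ Set.Icc (-d) d, ∀ y ∈ Set.Icc (-d) d, (b + y) ^ 2 + (a + x) ^ 2 ≠ 0 :=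
    fun x hx y hy => by rw [add_comm]; exact hPne x hx y hy
  have hfy : ∀ x ∈ Set.Icc (-d) d, ∀ y ∈ Set.Icc (-d) d, HasDerivAt (fun s => f x s) (fy x y) y := by
    intro x hx y hy
    have := (((hu1 _ (hnear x hx y hy)).comp_hasDerivAt y (hPy x y)).sub
      ((hasDerivAt_half_log_sq_add (hPne' x hx y hy)).1.const_mul γ)).sub_const m
    refine this.congr_of_eventuallyEq (.of_forall fun s => ?_)
    simp [f, add_comm ((b + s) ^ 2)]
  have hfyy : ∀ x ∈ Set.Icc (-d) d, ∀ y ∈ Set.Icc (-d) d, HasDerivAt (fun s => fy x s) (fyy x y) y :=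
    fun x hx y hy => ((hu2 _ (hnear x hx y hy) Complex.I).comp_hasDerivAt y (hPy x y)).sub
      ((hasDerivAt_half_log_sq_add (hPne' x hx y hy)).2.const_mul γ)
  have hcont : ContinuousOn (fun p : ℝ × ℝ => f p.1 p.2) (Set.Icc (-d) d ×ˢ Set.Icc (-d) d) := by
    rintro ⟨x, y⟩ ⟨hx, hy⟩
    have h1 : ContinuousAt (fun p : ℝ × ℝ => u (P p.1 p.2)) (x, y) :=
      ContinuousAt.comp (f := fun p : ℝ × ℝ => P p.1 p.2)
        (hu1 _ (hnear x hx y hy)).continuousAt (by simp only [P]; fun_prop)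
    have h2 : ContinuousAt (fun p : ℝ × ℝ => Real.log ((a + p.1) ^ 2 + (b + p.2) ^ 2)) (x, y) :=
      ContinuousAt.log (by fun_prop) (hPne x hx y hy)
    exact ((h1.sub ((h2.div_const 2).const_mul γ)).sub continuousAt_const).continuousWithinAt
  have hMf : ∀ x ∈ Set.Icc (-d) d, ∀ y ∈ Set.Icc (-d) d, |f x y| ≤ M := by
    intro x hx y hy
    have := hM _ (hnear x hx y hy)
    rwa [hPlog] at this
  have hKf : ∀ x ∈ Set.Icc (-d) d, ∀ y ∈ Set.Icc (-d) d, |fxx x y + fyy x y| < K := by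
    intro x hx y hy
    have h : fxx x y + fyy x y = lapl u (P x y) := by
      simp only [fxx, fyy, lapl, add_comm ((b + y) ^ 2)]
      ring
    rw [h]
    exact hK _ (hnear x hx y hy)
  have hY := abs_partial_deriv_le_of_laplacian_bound hd hcont hfx hfxx hfy hfyy hMf hKf
  have hX := abs_partial_deriv_le_of_laplacian_bound (f := fun x y => f y x)
    (fx := fun x y => fy y x) (fxx := fun x y => fyy y x) (fy := fun x y => fx y x)
    (fyy := fun x y => fxx y x) hd
    (hcont.comp (f := Prod.swap) continuous_swap.continuousOn fun p hp => ⟨hp.2, hp.1⟩)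
    (fun x hx y hy => hfy y hy x hx) (fun x hx y hy => hfyy y hy x hx)
    (fun x hx y hy => hfx y hy x hx) (fun x hx y hy => hfxx y hy x hx)
    (fun x hx y hy => hMf y hy x hx) (fun x hx y hy => by rw [add_comm]; exact hKf y hy x hx)
  have hinv : (γ : ℂ) / z₀ = γ * (a / (a ^ 2 + b ^ 2)) - Complex.I * (γ * (b / (a ^ 2 + b ^ 2))) := by
    have hn : ((a : ℂ) ^ 2 + b ^ 2) = z₀ * (a - Complex.I * b) := by
      conv_rhs => rw [← Complex.re_add_im z₀]
      linear_combination ((b : ℂ) ^ 2) * Complex.I_sq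
    have hne : (a : ℂ) - Complex.I * b ≠ 0 := by
      intro h
      have h' := hPne 0 ⟨by linarith, hd.le⟩ 0 ⟨by linarith, hd.le⟩
      rw [h, mul_zero] at hn
      apply h'
      simpa using (by exact_mod_cast hn : a ^ 2 + b ^ 2 = 0)
    rw [hn]
    field_simp
  have hkey : 2 * wirtR u z₀ - γ / z₀ = (fx 0 0 : ℂ) - Complex.I * (fy 0 0 : ℂ) := by
    rw [hinv]
    simp only [fx, fy, hP0, wirtR]
    push_cast
    simp only [add_zero, add_comm ((b : ℂ) ^ 2)]
    ring
  have hn : ‖(fx 0 0 : ℂ) - Complex.I * (fy 0 0 : ℂ)‖ ≤ |fx 0 0| + |fy 0 0| := by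
    refine (norm_sub_le _ _).trans ?_
    simp
  have e : 2 * M / d + K * d / 2 = (16 * M / ‖z₀‖ + K * ‖z₀‖ / 4) / 2 := by
    rw [hd_def]
    field_simp
    ring
  rw [hkey]
  linarith

/-- Corollary 1.2 (a): if λ(z)|dz| is a conformal metric on 𝔻∖{0} with curvature −k(z)
for a bounded nonpositive continuous k, ∬_𝔻 λ² dxdy < ∞, and conical singularity of
order γ > −1 at 0 (i.e. log λ(z) = γ·log|z| + r(z) with r continuous on 𝔻), then
z·Γ_λ(z) → γ as z → 0. -/
theorem connection_limit (k lam : ℂ → ℝ) (γ : ℝ) (r : ℂ → ℝ)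
    (hk_cont : ContinuousOn k (ball (0 : ℂ) 1 \ {0}))
    (hk_bdd : ∃ M : ℝ, ∀ z ∈ ball (0 : ℂ) 1 \ {0}, |k z| ≤ M)
    (hk_nonpos : ∀ z ∈ ball (0 : ℂ) 1 \ {0}, k z ≤ 0)
    (hlam_pos : ∀ z ∈ ball (0 : ℂ) 1 \ {0}, 0 < lam z)
    (hlam : ContDiffOn ℝ 2 lam (ball (0 : ℂ) 1 \ {0}))
    (hcurv : ∀ z ∈ ball (0 : ℂ) 1 \ {0},
      lapl (fun w => Real.log (lam w)) z = k z * lam z ^ 2)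
    (hint : ∫⁻ z in ball (0 : ℂ) 1, ENNReal.ofReal (lam z ^ 2) < ⊤)
    (hγ : -1 < γ)
    (hr_cont : ContinuousOn r (ball (0 : ℂ) 1))
    (hdecomp : ∀ z ∈ ball (0 : ℂ) 1 \ {0},
      Real.log (lam z) = γ * Real.log ‖z‖ + r z) :
    Tendsto (fun z => z * conn lam z) (𝓝[≠] (0 : ℂ)) (𝓝 (γ : ℂ)) := by
  obtain ⟨B, hB⟩ := hk_bdd
  have hopen : IsOpen (ball (0 : ℂ) 1 \ {0}) := isOpen_ball.sdiff isClosed_singleton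
  have hhalf : (1 / 2 : ℂ) ∈ ball (0 : ℂ) 1 \ {0} := by
    simp; norm_num
  have hB0 : 0 ≤ B := (abs_nonneg _).trans (hB _ hhalf)
  have hr0 : ContinuousAt r 0 := hr_cont.continuousAt (isOpen_ball.mem_nhds (by simp))
  rw [Metric.tendsto_nhds]
  intro ε hε
  obtain ⟨η, hη, hηε⟩ : ∃ η > 0, (17 + B) * η < ε :=
    ⟨ε / (2 * (17 + B)), by positivity, by field_simp; linarith⟩
  have hev : ∀ᶠ z in 𝓝[≠] (0 : ℂ), |r z - r 0| ≤ η ∧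
      Real.exp (2 * ((γ + 1) * Real.log ‖z‖ + r z)) < η ∧ ‖z‖ < 1 := by
    refine ((Metric.tendsto_nhds.1 hr0.tendsto η hη).filter_mono nhdsWithin_le_nhds
      |>.mono fun z hz => (by simpa [Real.dist_eq] using hz.le)).and
      (((tendsto_norm_sq_mul_exp_log hγ hr0).eventually_lt_const hη).and ?_)
    refine Filter.Eventually.filter_mono nhdsWithin_le_nhds ?_
    filter_upwards [ball_mem_nhds (0 : ℂ) one_pos] with z hz
    simpa using hz
  obtain ⟨δ, hδ, hδz⟩ := Metric.eventually_nhds_iff.1 (eventually_nhdsWithin_iff.1 hev)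
  refine eventually_nhdsWithin_iff.2 (Metric.eventually_nhds_iff.2 ⟨δ / 2, by positivity, ?_⟩)
  intro z₀ hz₀d hz₀
  have hz₀ : z₀ ≠ 0 := hz₀
  rw [dist_zero_right] at hz₀d
  have hpos : 0 < ‖z₀‖ := norm_pos_iff.2 hz₀
  have hnear : ∀ z, ‖z - z₀‖ ≤ ‖z₀‖ / 2 → ‖z₀‖ / 2 ≤ ‖z‖ ∧ z ∈ ball (0 : ℂ) 1 \ {0} ∧
      |r z - r 0| ≤ η ∧ Real.exp (2 * ((γ + 1) * Real.log ‖z‖ + r z)) < η := by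
    intro z hz
    have h1 : ‖z₀‖ / 2 ≤ ‖z‖ := by
      have := norm_sub_norm_le z₀ z
      rw [norm_sub_rev] at this
      linarith
    have h2 : ‖z‖ < δ := by
      have := norm_sub_norm_le z z₀
      linarith
    have hz0 : z ≠ 0 := norm_pos_iff.1 (by linarith)
    obtain ⟨h3, h4, h5⟩ := hδz (by rwa [dist_zero_right]) hz0
    exact ⟨h1, ⟨by simpa using h5, hz0⟩, h3, h4⟩
  have hmain := norm_two_wirtR_sub_le (u := fun w => Real.log (lam w)) (γ := γ) (m := r 0)
    (M := η) (K := (B + 1) * (4 * η / ‖z₀‖ ^ 2)) hz₀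
    (fun z hz => by
      have hz := (hnear z hz).2.1
      exact (hlam.contDiffAt (hopen.mem_nhds hz)).log (hlam_pos z hz).ne')
    (fun z hz => by
      obtain ⟨-, h2, h3, -⟩ := hnear z hz
      rw [hdecomp z h2, add_sub_cancel_left]
      exact h3)
    (fun z hz => by
      obtain ⟨h1, h2, -, h4⟩ := hnear z hz
      have hzpos : 0 < ‖z‖ := by linarith
      have hl := hlam_pos z h2
      have hexp : Real.exp (2 * ((γ + 1) * Real.log ‖z‖ + r z)) = (‖z‖ * lam z) ^ 2 := by
        have : (γ + 1) * Real.log ‖z‖ + r z = Real.log (‖z‖ * lam z) := by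
          rw [Real.log_mul hzpos.ne' hl.ne', hdecomp z h2]
          ring
        rw [this, two_mul, Real.exp_add, Real.exp_log (by positivity)]
        ring
      rw [hexp] at h4
      rw [hcurv z h2, abs_mul, abs_of_pos (pow_pos hl 2)]
      have h5 : lam z ^ 2 ≤ 4 * η / ‖z₀‖ ^ 2 := by
        rw [le_div_iff₀ (by positivity)]
        have h6 : ‖z₀‖ ^ 2 ≤ 4 * ‖z‖ ^ 2 := by nlinarith
        nlinarith [mul_le_mul_of_nonneg_left h6 (sq_nonneg (lam z))]
      calc |k z| * lam z ^ 2 < (B + 1) * lam z ^ 2 :=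
            mul_lt_mul_of_pos_right (by linarith [hB z h2]) (pow_pos hl 2)
        _ ≤ _ := mul_le_mul_of_nonneg_left h5 (by linarith))
  have heq : z₀ * conn lam z₀ - γ
      = z₀ * (2 * wirtR (fun w => Real.log (lam w)) z₀ - γ / z₀) := by
    rw [conn]
    field_simp
  rw [dist_eq_norm, heq, norm_mul]
  calc _ ≤ ‖z₀‖ * _ := mul_le_mul_of_nonneg_left hmain hpos.le
    _ = (17 + B) * η := by field_simp; ring
    _ < ε := hηε
end

section
/- Let k : 𝔻∖{0} → ℝ be a bounded, nonpositive, continuous function that extends to a locally Hölder continuous function on 𝔻, and let λ : 𝔻∖{0} → (0,∞) be a C² function such that the conformal metric λ(z)|dz| has curvature −k(z) on 𝔻∖{0} (i.e. Δ(log λ)(z) = k(z)·λ(z)² for all z ∈ 𝔻∖{0}) and ∬_𝔻 λ(z)² dxdy < ∞. Let γ > −1 be the order of the conical singularity of λ(z)|dz| at z = 0. Then lim_{z→0} z²·S_λ(z) = −γ(2+γ)/2, where S_λ(z) = ∂Γ_λ/∂z (z) − Γ_λ(z)²/2 is the Schwarzian of λ(z)|dz| and Γ_λ(z) = 2·∂(log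 λ)/∂z (z) its connection. -/
open Metric MeasureTheory Filter
open scoped ENNReal NNReal Topology

/-- The real-linear map `h ↦ p * h + q * conj h`. -/
noncomputable def wirtingerCLM (p q : ℂ) : ℂ →L[ℝ] ℂ :=
  p • ContinuousLinearMap.id ℝ ℂ + q • (Complex.conjCLE : ℂ →L[ℝ] ℂ)

@[simp]
theorem wirtingerCLM_apply (p q h : ℂ) :
    wirtingerCLM p q h = p * h + q * (starRingEnd ℂ) h := by
  simp [wirtingerCLM]

/-- The (unnormalized) `n`-th Fourier coefficient of `w` on the circle of center `c`
and radius `t`. -/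
noncomputable def circleCoeff (n : ℕ) (w : ℂ → ℂ) (c : ℂ) (t : ℝ) : ℂ :=
  ∫ θ in (0 : ℝ)..2 * Real.pi, w (circleMap c t θ) * Complex.exp (-(n * θ * Complex.I))

theorem circleMap_mem_ball_of_abs_lt {c : ℂ} {R t : ℝ} (ht : |t| < R) (θ : ℝ) :
    circleMap c t θ ∈ ball c R := by
  simpa [circleMap] using ht

theorem hasDerivAt_circleMap_radius (c : ℂ) (t θ : ℝ) :
    HasDerivAt (fun s : ℝ => circleMap c s θ) (Complex.exp (θ * Complex.I)) t := by
  have h := ((Complex.ofRealCLM.hasDerivAt (x := t)).mul_const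
    (Complex.exp (θ * Complex.I))).const_add c
  simpa [circleMap] using h

theorem ContinuousOn.comp_circleMap {w : ℂ → ℂ} {c : ℂ} {R t : ℝ}
    (hw : ContinuousOn w (ball c R)) (ht : |t| < R) :
    Continuous fun θ : ℝ => w (circleMap c t θ) :=
  hw.comp_continuous (continuous_circleMap c t) fun θ => circleMap_mem_ball_of_abs_lt ht θ

theorem norm_circleCoeff_le {n : ℕ} {w : ℂ → ℂ} {c : ℂ} {t B : ℝ}
    (hB : ∀ θ : ℝ, ‖w (circleMap c t θ)‖ ≤ B) :
    ‖circleCoeff n w c t‖ ≤ 2 * Real.pi * B := by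
  have h := intervalIntegral.norm_integral_le_of_norm_le_const (a := 0) (b := 2 * Real.pi)
    (f := fun θ : ℝ => w (circleMap c t θ) * Complex.exp (-(n * θ * Complex.I))) (C := B)
    (fun θ _ => by
      have : ‖Complex.exp (-(n * θ * Complex.I))‖ = 1 := by
        rw [Complex.norm_exp]; simp
      rw [norm_mul, this, mul_one]
      exact hB θ)
  rw [sub_zero, abs_of_pos Real.two_pi_pos] at h
  rw [circleCoeff]
  linarith

theorem integral_exp_neg_nat_mul_I {n : ℕ} (hn : n ≠ 0) :
    ∫ θ in (0 : ℝ)..2 * Real.pi, Complex.exp (-(n * θ * Complex.I)) = 0 := by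
  have hc : -(n * Complex.I) ≠ 0 := by simp [hn]
  have h := integral_exp_mul_complex (a := 0) (b := 2 * Real.pi) hc
  have h2 : Complex.exp (-(n * Complex.I) * ((2 * Real.pi : ℝ) : ℂ)) = 1 := by
    rw [Complex.exp_eq_one_iff]
    exact ⟨-n, by push_cast; ring⟩
  rw [h2] at h
  simp only [Complex.ofReal_zero, mul_zero, Complex.exp_zero, sub_self, zero_div] at h
  rw [← h]
  congr 1
  ext θ
  ring_nf

theorem circleCoeff_sub_const {n : ℕ} (hn : n ≠ 0) {w : ℂ → ℂ} {c : ℂ} {R t : ℝ}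
    (hw : ContinuousOn w (ball c R)) (ht : |t| < R) (a : ℂ) :
    circleCoeff n (fun z => w z - a) c t = circleCoeff n w c t := by
  have hw' := hw.comp_circleMap ht
  simp only [circleCoeff, sub_mul]
  rw [intervalIntegral.integral_sub, intervalIntegral.integral_const_mul,
    integral_exp_neg_nat_mul_I hn, mul_zero, sub_zero]
  · exact Continuous.intervalIntegrable (hw'.mul (by fun_prop)) _ _
  · exact Continuous.intervalIntegrable (by fun_prop) _ _

section Derivative

variable {w P Q : ℂ → ℂ} {c : ℂ} {R : ℝ}

theorem hasDerivAt_circleCoeff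
    (hw : ∀ z ∈ ball c R, HasFDerivAt w (wirtingerCLM (P z) (Q z)) z)
    (hP : ContinuousOn P (ball c R)) (hQ : ContinuousOn Q (ball c R))
    (n : ℕ) {t : ℝ} (ht : |t| < R) :
    HasDerivAt (circleCoeff n w c)
      (∫ θ in (0 : ℝ)..2 * Real.pi, (P (circleMap c t θ) * Complex.exp (θ * Complex.I) +
        Q (circleMap c t θ) * Complex.exp (-(θ * Complex.I))) *
          Complex.exp (-(n * θ * Complex.I))) t := by
  obtain ⟨R', htR', hR'⟩ := exists_between ht
  have hwc : ContinuousOn w (ball c R) := fun z hz => (hw z hz).continuousAt.continuousWithinAt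
  have hsub : closedBall c R' ⊆ ball c R := closedBall_subset_ball hR'
  obtain ⟨MP, hMP⟩ := (isCompact_closedBall c R').exists_bound_of_continuousOn (hP.mono hsub)
  obtain ⟨MQ, hMQ⟩ := (isCompact_closedBall c R').exists_bound_of_continuousOn (hQ.mono hsub)
  have hs : {x : ℝ | |x| < R'} ∈ 𝓝 t :=
    (isOpen_lt continuous_abs continuous_const).mem_nhds htR'
  refine (intervalIntegral.hasDerivAt_integral_of_dominated_loc_of_deriv_le
    (μ := volume) (s := {x : ℝ | |x| < R'})
    (F := fun s θ => w (circleMap c s θ) * Complex.exp (-(n * θ * Complex.I)))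
    (F' := fun s θ => (P (circleMap c s θ) * Complex.exp (θ * Complex.I) +
        Q (circleMap c s θ) * Complex.exp (-(θ * Complex.I))) *
          Complex.exp (-(n * θ * Complex.I))) (bound := fun _ => MP + MQ)
    hs ?_ ?_ ?_ ?_ ?_ ?_).2
  · filter_upwards [hs] with s hs
    have := hwc.comp_circleMap (hs.trans hR')
    exact Continuous.aestronglyMeasurable (this.mul (by fun_prop))
  · have := hwc.comp_circleMap ht
    exact Continuous.intervalIntegrable (this.mul (by fun_prop)) _ _
  · have hP' := hP.comp_circleMap ht
    have hQ' := hQ.comp_circleMap ht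
    exact Continuous.aestronglyMeasurable (((hP'.mul (by fun_prop)).add (hQ'.mul (by fun_prop))).mul (by fun_prop))
  · refine ae_of_all _ fun θ _ s hs => ?_
    have hz : circleMap c s θ ∈ closedBall c R' :=
      ball_subset_closedBall (circleMap_mem_ball_of_abs_lt hs θ)
    have h1 : ‖Complex.exp (-(n * θ * Complex.I))‖ = 1 := by rw [Complex.norm_exp]; simp
    have h2 : ‖Complex.exp (-(θ * Complex.I))‖ = 1 := by rw [Complex.norm_exp]; simp
    rw [norm_mul, h1, mul_one]
    refine (norm_add_le _ _).trans ?_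
    rw [norm_mul, norm_mul, h2, Complex.norm_exp_ofReal_mul_I, mul_one, mul_one]
    exact add_le_add (hMP _ hz) (hMQ _ hz)
  · exact intervalIntegrable_const
  · refine ae_of_all _ fun θ _ s hs => ?_
    have h := (hw _ (circleMap_mem_ball_of_abs_lt (hs.trans hR') θ)).comp_hasDerivAt s
      (hasDerivAt_circleMap_radius c s θ)
    refine (h.mul_const _).congr_deriv ?_
    simp [← Complex.exp_conj]

theorem nat_mul_circleCoeff
    (hw : ∀ z ∈ ball c R, HasFDerivAt w (wirtingerCLM (P z) (Q z)) z)
    (hP : ContinuousOn P (ball c R)) (hQ : ContinuousOn Q (ball c R))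
    (n : ℕ) {t : ℝ} (ht : |t| < R) :
    n * circleCoeff n w c t =
      t * ∫ θ in (0 : ℝ)..2 * Real.pi, (P (circleMap c t θ) * Complex.exp (θ * Complex.I) -
        Q (circleMap c t θ) * Complex.exp (-(θ * Complex.I))) *
          Complex.exp (-(n * θ * Complex.I)) := by
  have hwc : ContinuousOn w (ball c R) := fun z hz => (hw z hz).continuousAt.continuousWithinAt
  have hw' := hwc.comp_circleMap ht
  have hP' := hP.comp_circleMap ht
  have hQ' := hQ.comp_circleMap ht
  have hexp (θ : ℝ) : HasDerivAt (fun θ : ℝ => Complex.exp (-(n * θ * Complex.I)))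
      (Complex.exp (-(n * θ * Complex.I)) * -(n * Complex.I)) θ := by
    have h := (((Complex.ofRealCLM.hasDerivAt (x := θ)).const_mul (n : ℂ)).mul_const
      Complex.I).neg.cexp
    simpa using h
  have hder (θ : ℝ) : HasDerivAt
      (fun θ : ℝ => w (circleMap c t θ) * Complex.exp (-(n * θ * Complex.I)))
      (Complex.I * (t * ((P (circleMap c t θ) * Complex.exp (θ * Complex.I) -
        Q (circleMap c t θ) * Complex.exp (-(θ * Complex.I))) *
          Complex.exp (-(n * θ * Complex.I)))
        - n * (w (circleMap c t θ) * Complex.exp (-(n * θ * Complex.I))))) θ := by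
    have h := ((hw _ (circleMap_mem_ball_of_abs_lt ht θ)).comp_hasDerivAt θ
      (hasDerivAt_circleMap c t θ)).mul (hexp θ)
    refine h.congr_deriv ?_
    simp [circleMap, ← Complex.exp_conj]
    ring
  have hint := intervalIntegral.integral_eq_sub_of_hasDerivAt (a := 0) (b := 2 * Real.pi)
    (fun θ _ => hder θ) (Continuous.intervalIntegrable (continuous_const.mul ((continuous_const.mul (((hP'.mul (by fun_prop)).sub (hQ'.mul (by fun_prop))).mul (by fun_prop))).sub (continuous_const.mul (hw'.mul (by fun_prop))))) _ _)
  have hper : Complex.exp (-(n * ((2 * Real.pi : ℝ) : ℂ) * Complex.I)) = 1 := by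
    rw [Complex.exp_eq_one_iff]
    exact ⟨-n, by push_cast; ring⟩
  have hper' : circleMap c t (2 * Real.pi) = circleMap c t 0 := by
    simpa using (periodic_circleMap c t) 0
  rw [hper, hper', intervalIntegral.integral_const_mul, intervalIntegral.integral_sub,
    intervalIntegral.integral_const_mul, intervalIntegral.integral_const_mul] at hint
  · simp only [Complex.ofReal_zero, mul_zero, zero_mul, neg_zero, Complex.exp_zero, sub_self,
      mul_eq_zero, Complex.I_ne_zero, false_or] at hint
    rw [circleCoeff]
    exact (sub_eq_zero.1 hint).symm
  · exact Continuous.intervalIntegrable (continuous_const.mul (((hP'.mul (by fun_prop)).sub (hQ'.mul (by fun_prop))).mul (by fun_prop))) _ _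
  · exact Continuous.intervalIntegrable (continuous_const.mul (hw'.mul (by fun_prop))) _ _

theorem exists_hasDerivAt_circleCoeff_conj
    (hw : ∀ z ∈ ball c R, HasFDerivAt w (wirtingerCLM (P z) (Q z)) z)
    (hP : ContinuousOn P (ball c R)) (hQ : ContinuousOn Q (ball c R))
    (n : ℕ) {t : ℝ} (ht : |t| < R) :
    ∃ D : ℂ, HasDerivAt (circleCoeff n w c) D t ∧
      t * D - n * circleCoeff n w c t = 2 * t * circleCoeff (n + 1) Q c t := by
  have hP' := hP.comp_circleMap ht
  have hQ' := hQ.comp_circleMap ht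
  refine ⟨_, hasDerivAt_circleCoeff hw hP hQ n ht, ?_⟩
  rw [nat_mul_circleCoeff hw hP hQ n ht, ← mul_sub, ← intervalIntegral.integral_sub, circleCoeff,
    mul_comm 2 (t : ℂ), mul_assoc, ← intervalIntegral.integral_const_mul (2 : ℂ)]
  · congr 1
    refine intervalIntegral.integral_congr fun θ _ => ?_
    have : Complex.exp (-(((n + 1 : ℕ) : ℂ) * θ * Complex.I)) =
        Complex.exp (-(θ * Complex.I)) * Complex.exp (-(n * θ * Complex.I)) := by
      rw [← Complex.exp_add]; push_cast; ring_nf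
    rw [this]
    ring
  · exact Continuous.intervalIntegrable (((hP'.mul (by fun_prop)).add (hQ'.mul (by fun_prop))).mul (by fun_prop)) _ _
  · exact Continuous.intervalIntegrable (((hP'.mul (by fun_prop)).sub (hQ'.mul (by fun_prop))).mul (by fun_prop)) _ _

theorem exists_hasDerivAt_circleCoeff
    (hw : ∀ z ∈ ball c R, HasFDerivAt w (wirtingerCLM (P z) (Q z)) z)
    (hP : ContinuousOn P (ball c R)) (hQ : ContinuousOn Q (ball c R))
    (n : ℕ) {t : ℝ} (ht : |t| < R) :
    ∃ D : ℂ, HasDerivAt (circleCoeff (n + 1) w c) D t ∧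
      t * D + (n + 1) * circleCoeff (n + 1) w c t = 2 * t * circleCoeff n P c t := by
  have hP' := hP.comp_circleMap ht
  have hQ' := hQ.comp_circleMap ht
  refine ⟨_, hasDerivAt_circleCoeff hw hP hQ (n + 1) ht, ?_⟩
  have h := nat_mul_circleCoeff hw hP hQ (n + 1) ht
  rw [Nat.cast_add_one] at h
  rw [h, ← mul_add, ← intervalIntegral.integral_add, circleCoeff,
    mul_comm 2 (t : ℂ), mul_assoc, ← intervalIntegral.integral_const_mul (2 : ℂ)]
  · congr 1
    refine intervalIntegral.integral_congr fun θ _ => ?_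
    have : Complex.exp (-(n * θ * Complex.I)) = Complex.exp (θ * Complex.I) *
        Complex.exp (-(((n + 1 : ℕ) : ℂ) * θ * Complex.I)) := by
      rw [← Complex.exp_add]; push_cast; ring_nf
    rw [this]
    push_cast
    ring
  · exact Continuous.intervalIntegrable (((hP'.mul (by fun_prop)).add (hQ'.mul (by fun_prop))).mul (by fun_prop)) _ _
  · exact Continuous.intervalIntegrable (((hP'.mul (by fun_prop)).sub (hQ'.mul (by fun_prop))).mul (by fun_prop)) _ _

theorem circleCoeff_zero_radius (n : ℕ) (w : ℂ → ℂ) (c : ℂ) :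
    circleCoeff n w c 0 = if n = 0 then 2 * Real.pi * w c else 0 := by
  simp only [circleCoeff, circleMap_zero_radius, Function.const_apply]
  rw [intervalIntegral.integral_const_mul]
  split_ifs with hn
  · simp [hn, mul_comm]
  · rw [integral_exp_neg_nat_mul_I hn, mul_zero]

theorem hasDerivAt_circleCoeff_one_zero
    (hw : ∀ z ∈ ball c R, HasFDerivAt w (wirtingerCLM (P z) (Q z)) z)
    (hP : ContinuousOn P (ball c R)) (hQ : ContinuousOn Q (ball c R)) (hR : 0 < R) :
    HasDerivAt (circleCoeff 1 w c) (2 * Real.pi * P c) 0 := by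
  refine (hasDerivAt_circleCoeff hw hP hQ 1 (by simpa using hR)).congr_deriv ?_
  have h0 := circleCoeff_zero_radius 0 P c
  have h2 := circleCoeff_zero_radius 2 Q c
  rw [if_pos rfl] at h0
  rw [if_neg two_ne_zero] at h2
  rw [← h0, ← add_zero (circleCoeff 0 P c 0), ← h2]
  simp only [circleCoeff, circleMap_zero_radius, Function.const_apply]
  rw [← intervalIntegral.integral_add]
  · congr 1
    ext θ
    rw [add_mul, mul_assoc, mul_assoc (Q c), ← Complex.exp_add, ← Complex.exp_add]
    push_cast
    ring_nf
  · exact Continuous.intervalIntegrable (by fun_prop) _ _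
  · exact Continuous.intervalIntegrable (by fun_prop) _ _

end Derivative

/-- A mean value inequality on a right-open neighbourhood of a possibly singular point. -/
theorem norm_sub_le_of_norm_deriv_le_rpow {φ φ' : ℝ → ℂ} {L : ℂ} {T C α : ℝ} (hT : 0 < T)
    (hα : 0 < α) (hC : 0 ≤ C) (hφ : ∀ t ∈ Set.Ioc 0 T, HasDerivAt φ (φ' t) t)
    (hbound : ∀ t ∈ Set.Ioc 0 T, ‖φ' t‖ ≤ C * t ^ (α - 1))
    (hL : Tendsto φ (𝓝[>] 0) (𝓝 L)) :
    ‖φ T - L‖ ≤ C * T ^ α / α := by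
  have key : ∀ ε ∈ Set.Ioo 0 T, ‖φ T - φ ε‖ ≤ C * T ^ α / α := by
    intro ε hε
    have hpos : ∀ x ∈ Set.Icc ε T, 0 < x := fun x hx => hε.1.trans_le hx.1
    have hB (x : ℝ) (hx : 0 < x) :
        HasDerivAt (fun x => C * x ^ α / α - C * ε ^ α / α) (C * x ^ (α - 1)) x := by
      refine ((((Real.hasDerivAt_rpow_const (p := α) (Or.inl hx.ne')).const_mul C).div_const
        α).sub_const _).congr_deriv ?_
      field_simp
    have h := image_norm_le_of_norm_deriv_right_le_deriv_boundary'
      (f := fun t => φ t - φ ε) (f' := φ') (a := ε) (b := T)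
      (B := fun x => C * x ^ α / α - C * ε ^ α / α) (B' := fun x => C * x ^ (α - 1))
      (fun x hx => ((hφ x ⟨hpos x hx, hx.2⟩).sub_const _).continuousAt.continuousWithinAt)
      (fun x hx => ((hφ x ⟨hpos x ⟨hx.1, hx.2.le⟩, hx.2.le⟩).sub_const _).hasDerivWithinAt)
      (by simp)
      (fun x hx => (hB x (hpos x hx)).continuousAt.continuousWithinAt)
      (fun x hx => (hB x (hpos x ⟨hx.1, hx.2.le⟩)).hasDerivWithinAt)
      (fun x hx => hbound x ⟨hpos x ⟨hx.1, hx.2.le⟩, hx.2.le⟩)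
      (Set.right_mem_Icc.2 hε.2.le)
    refine h.trans (sub_le_self _ ?_)
    have := Real.rpow_nonneg hε.1.le α
    positivity
  refine le_of_tendsto (tendsto_const_nhds.sub hL).norm ?_
  filter_upwards [Ioo_mem_nhdsGT hT] with ε hε using key ε hε

section Estimates

variable {v g p : ℂ → ℂ} {f : ℂ → ℂ} {c : ℂ} {R : ℝ}

/-- Interior gradient estimate for the Poisson equation, with `g = 2 ∂v` and `f = Δv`. -/
theorem norm_wirtinger_le
    (hv : ∀ z ∈ ball c R, HasFDerivAt v (wirtingerCLM (g z / 2) ((starRingEnd ℂ) (g z) / 2)) z)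
    (hg : ∀ z ∈ ball c R, HasFDerivAt g (wirtingerCLM (p z) (f z / 2)) z)
    (hp : ContinuousOn p (ball c R)) (hf : ContinuousOn f (ball c R))
    {T B F : ℝ} (hT : 0 < T) (hTR : T < R) (hB : ∀ z ∈ ball c R, ‖v z‖ ≤ B)
    (hF : ∀ z ∈ ball c R, ‖f z‖ ≤ F) :
    ‖g c‖ ≤ 2 * B / T + 2 * F * T := by
  have hR := hT.trans hTR
  have hπ := Real.pi_pos
  have hF0 : 0 ≤ F := (norm_nonneg _).trans (hF c (mem_ball_self hR))
  have hgc : ContinuousOn g (ball c R) := fun z hz => (hg z hz).continuousAt.continuousWithinAt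
  have hf2 : ContinuousOn (fun z => f z / 2) (ball c R) := hf.div_const 2
  have hg2 : ContinuousOn (fun z => g z / 2) (ball c R) := hgc.div_const 2
  have hgbar : ContinuousOn (fun z => (starRingEnd ℂ) (g z) / 2) (ball c R) :=
    (Complex.continuous_conj.comp_continuousOn hgc).div_const 2
  have habs {t : ℝ} (ht : t ∈ Set.Ioc 0 T) : |t| < R := by
    rw [abs_of_pos ht.1]; exact ht.2.trans_lt hTR
  have hG : ∀ t ∈ Set.Ioc 0 T, ‖circleCoeff 0 g c t - 2 * Real.pi * g c‖ ≤
      2 * Real.pi * F * t := by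
    intro t ht
    choose! D hD hD' using fun (s : ℝ) (hs : s ∈ Set.Ioc 0 t) =>
      exists_hasDerivAt_circleCoeff_conj hg hp hf2 0 (habs ⟨hs.1, hs.2.trans ht.2⟩)
    have h := norm_sub_le_of_norm_deriv_le_rpow (φ := circleCoeff 0 g c) (φ' := D)
      (L := 2 * Real.pi * g c) (C := 2 * Real.pi * F) (α := 1) ht.1 one_pos (by positivity) hD ?_ ?_
    · simpa using h
    · intro s hs
      have h1 := hD' s hs
      have hs0 : (s : ℂ) ≠ 0 := Complex.ofReal_ne_zero.2 hs.1.ne'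
      have h2 : D s = 2 * circleCoeff (0 + 1) (fun z => f z / 2) c s := by
        refine mul_left_cancel₀ hs0 ?_
        rw [Nat.cast_zero, zero_mul, sub_zero] at h1
        rw [h1]; ring
      have h3 := norm_circleCoeff_le (n := 0 + 1) (w := fun z => f z / 2) (c := c) (t := s)
        (B := F / 2) fun θ => by
          rw [norm_div, Complex.norm_two]
          have := hF _ (circleMap_mem_ball_of_abs_lt (habs ⟨hs.1, hs.2.trans ht.2⟩) θ)
          linarith
      rw [h2, norm_mul, Complex.norm_two]
      simp only [sub_self, Real.rpow_zero]
      linarith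
    · have h0 := circleCoeff_zero_radius 0 g c
      rw [if_pos rfl] at h0
      rw [← h0]
      exact (hasDerivAt_circleCoeff hg hp hf2 0
        (by simpa using hR)).continuousAt.tendsto.mono_left nhdsWithin_le_nhds
  choose! D hD hD' using fun (s : ℝ) (hs : s ∈ Set.Ioc 0 T) =>
      exists_hasDerivAt_circleCoeff hv hg2 hgbar 0 (habs hs)
  have hA := norm_sub_le_of_norm_deriv_le_rpow
    (φ := fun t : ℝ => t * circleCoeff (0 + 1) v c t - Real.pi * g c * t ^ 2)
    (φ' := fun t : ℝ => t * (circleCoeff 0 g c t - 2 * Real.pi * g c))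
    (L := 0) (C := 2 * Real.pi * F * T ^ 2) (α := 1) hT one_pos (by positivity) ?_ ?_ ?_
  · have hvT := norm_circleCoeff_le (n := 0 + 1) (w := v) (c := c) (t := T) (B := B) fun θ =>
      hB _ (circleMap_mem_ball_of_abs_lt (habs ⟨hT, le_rfl⟩) θ)
    rw [sub_zero, Real.rpow_one, div_one] at hA
    have h1 : ‖(Real.pi : ℂ) * g c * (T : ℂ) ^ 2‖ ≤
        T * (2 * Real.pi * B) + 2 * Real.pi * F * T ^ 2 * T := by
      have h2 := norm_sub_norm_le ((Real.pi : ℂ) * g c * (T : ℂ) ^ 2)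
        ((T : ℂ) * circleCoeff (0 + 1) v c T)
      rw [norm_sub_rev] at h2
      have h3 : ‖(T : ℂ) * circleCoeff (0 + 1) v c T‖ ≤ T * (2 * Real.pi * B) := by
        rw [norm_mul, Complex.norm_of_nonneg hT.le]
        exact mul_le_mul_of_nonneg_left hvT hT.le
      linarith
    rw [norm_mul, norm_mul, norm_pow, Complex.norm_of_nonneg hT.le,
      Complex.norm_of_nonneg hπ.le] at h1
    have h4 : ‖g c‖ * (Real.pi * T ^ 2) ≤ (2 * B / T + 2 * F * T) * (Real.pi * T ^ 2) := by
      calc _ = Real.pi * ‖g c‖ * T ^ 2 := by ring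
        _ ≤ _ := h1
        _ = _ := by field_simp
    exact le_of_mul_le_mul_right h4 (by positivity)
  · intro t ht
    have ht' : HasDerivAt (fun t : ℝ => (t : ℂ)) 1 t := Complex.ofRealCLM.hasDerivAt
    refine ((ht'.mul (hD t ht)).sub ((ht'.pow 2).const_mul _)).congr_deriv ?_
    have h1 := hD' t ht
    have h2 : circleCoeff 0 (fun z => g z / 2) c t = circleCoeff 0 g c t / 2 := by
      simp only [circleCoeff, ← intervalIntegral.integral_div]
      congr 1
      ext θ
      ring
    rw [h2] at h1
    push_cast at h1 ⊢
    linear_combination h1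
  · intro t ht
    rw [norm_mul, Complex.norm_of_nonneg ht.1.le, sub_self, Real.rpow_zero, mul_one]
    calc t * _ ≤ t * (2 * Real.pi * F * t) := mul_le_mul_of_nonneg_left (hG t ht) ht.1.le
      _ = 2 * Real.pi * F * t ^ 2 := by ring
      _ ≤ _ := by
        have := ht.1.le
        have := ht.2
        gcongr
  · have h1 := (hasDerivAt_circleCoeff hv hg2 hgbar (0 + 1)
        (t := 0) (by simpa using hR)).continuousAt
    have h2 : ContinuousAt (fun t : ℝ =>
        (t : ℂ) * circleCoeff (0 + 1) v c t - Real.pi * g c * (t : ℂ) ^ 2) 0 := by fun_prop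
    simpa using h2.tendsto.mono_left nhdsWithin_le_nhds

/-- Interior Schauder estimate at a point for the Poisson equation, with `g = 2 ∂v`, `p = ∂g`
and `f = Δv`. -/
theorem norm_wirtinger_wirtinger_le
    (hv : ∀ z ∈ ball c R, HasFDerivAt v (wirtingerCLM (g z / 2) ((starRingEnd ℂ) (g z) / 2)) z)
    (hg : ∀ z ∈ ball c R, HasFDerivAt g (wirtingerCLM (p z) (f z / 2)) z)
    (hp : ContinuousOn p (ball c R)) (hf : ContinuousOn f (ball c R))
    {T B H α : ℝ} (hT : 0 < T) (hTR : T < R) (hα : 0 < α) (hB : ∀ z ∈ ball c R, ‖v z‖ ≤ B)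
    (hH0 : 0 ≤ H) (hH : ∀ z ∈ ball c R, ‖f z - f c‖ ≤ H * ‖z - c‖ ^ α) :
    ‖p c‖ ≤ 4 * B / T ^ 2 + 4 * H * T ^ α / α := by
  have hR := hT.trans hTR
  have hπ := Real.pi_pos
  have hgc : ContinuousOn g (ball c R) := fun z hz => (hg z hz).continuousAt.continuousWithinAt
  have hf2 : ContinuousOn (fun z => f z / 2) (ball c R) := hf.div_const 2
  have hg2 : ContinuousOn (fun z => g z / 2) (ball c R) := hgc.div_const 2
  have hgbar : ContinuousOn (fun z => (starRingEnd ℂ) (g z) / 2) (ball c R) :=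
    (Complex.continuous_conj.comp_continuousOn hgc).div_const 2
  have habs {t : ℝ} (ht : t ∈ Set.Ioc 0 T) : |t| < R := by
    rw [abs_of_pos ht.1]; exact ht.2.trans_lt hTR
  have hG : ∀ t ∈ Set.Ioc 0 T, ‖circleCoeff 1 g c t / t - 2 * Real.pi * p c‖ ≤
      2 * Real.pi * H * t ^ α / α := by
    intro t ht
    choose! D hD hD' using fun (s : ℝ) (hs : s ∈ Set.Ioc 0 t) =>
      exists_hasDerivAt_circleCoeff_conj hg hp hf2 1 (habs ⟨hs.1, hs.2.trans ht.2⟩)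
    refine norm_sub_le_of_norm_deriv_le_rpow (φ := fun s : ℝ => circleCoeff 1 g c s / s)
      (φ' := fun s => 2 * circleCoeff (1 + 1) (fun z => f z / 2) c s / s)
      (L := 2 * Real.pi * p c) (C := 2 * Real.pi * H) (α := α) ht.1 hα (by positivity) ?_ ?_ ?_
    · intro s hs
      have hs0 : (s : ℂ) ≠ 0 := Complex.ofReal_ne_zero.2 hs.1.ne'
      have hs' : HasDerivAt (fun t : ℝ => (t : ℂ)) 1 s := Complex.ofRealCLM.hasDerivAt
      refine ((hD s hs).div hs' hs0).congr_deriv ?_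
      have h1 := hD' s hs
      push_cast at h1
      rw [div_eq_div_iff (pow_ne_zero 2 hs0) hs0]
      linear_combination (s : ℂ) * h1
    · intro s hs
      have hsR := habs ⟨hs.1, hs.2.trans ht.2⟩
      have h3 := norm_circleCoeff_le (n := 1 + 1) (w := fun z => f z / 2 - f c / 2) (c := c)
        (t := s) (B := H * s ^ α / 2) fun θ => by
          have := hH _ (circleMap_mem_ball_of_abs_lt hsR θ)
          rw [circleMap_sub_center, norm_circleMap_zero, abs_of_pos hs.1] at this
          rw [← sub_div, norm_div, Complex.norm_two]
          linarith
      rw [circleCoeff_sub_const two_ne_zero hf2 hsR] at h3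
      rw [norm_div, norm_mul, Complex.norm_two, Complex.norm_of_nonneg hs.1.le,
        Real.rpow_sub_one hs.1.ne', ← mul_div_assoc]
      refine div_le_div_of_nonneg_right ?_ hs.1.le
      change 2 * ‖circleCoeff 2 _ c s‖ ≤ _
      linarith
    · have h0 := (hasDerivAt_circleCoeff_one_zero hg hp hf2 hR).tendsto_slope_zero_right
      refine h0.congr' ?_
      filter_upwards [self_mem_nhdsWithin] with s hs
      rw [circleCoeff_zero_radius, if_neg one_ne_zero, zero_add, sub_zero, Complex.real_smul,
        Complex.ofReal_inv, div_eq_inv_mul]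
  choose! D hD hD' using fun (s : ℝ) (hs : s ∈ Set.Ioc 0 T) =>
      exists_hasDerivAt_circleCoeff hv hg2 hgbar 1 (habs hs)
  have hA := norm_sub_le_of_norm_deriv_le_rpow
    (φ := fun t : ℝ => t ^ 2 * circleCoeff (1 + 1) v c t - Real.pi / 2 * p c * t ^ 4)
    (φ' := fun t : ℝ => t ^ 3 * (circleCoeff 1 g c t / t - 2 * Real.pi * p c))
    (L := 0) (C := T ^ 3 * (2 * Real.pi * H * T ^ α / α)) (α := 1) hT one_pos
    (by positivity) ?_ ?_ ?_
  · have hvT := norm_circleCoeff_le (n := 1 + 1) (w := v) (c := c) (t := T) (B := B) fun θ =>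
      hB _ (circleMap_mem_ball_of_abs_lt (habs ⟨hT, le_rfl⟩) θ)
    rw [sub_zero, Real.rpow_one, div_one] at hA
    have h1 : ‖(Real.pi / 2 : ℂ) * p c * (T : ℂ) ^ 4‖ ≤
        T ^ 2 * (2 * Real.pi * B) + T ^ 3 * (2 * Real.pi * H * T ^ α / α) * T := by
      have h2 := norm_sub_norm_le ((Real.pi / 2 : ℂ) * p c * (T : ℂ) ^ 4)
        ((T : ℂ) ^ 2 * circleCoeff (1 + 1) v c T)
      rw [norm_sub_rev] at h2
      have h3 : ‖(T : ℂ) ^ 2 * circleCoeff (1 + 1) v c T‖ ≤ T ^ 2 * (2 * Real.pi * B) := by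
        rw [norm_mul, norm_pow, Complex.norm_of_nonneg hT.le]
        gcongr
      linarith
    rw [norm_mul, norm_mul, norm_pow, norm_div, Complex.norm_two, Complex.norm_of_nonneg hT.le,
      Complex.norm_of_nonneg hπ.le] at h1
    have h4 : ‖p c‖ * (Real.pi / 2 * T ^ 4) ≤
        (4 * B / T ^ 2 + 4 * H * T ^ α / α) * (Real.pi / 2 * T ^ 4) := by
      calc _ = Real.pi / 2 * ‖p c‖ * T ^ 4 := by ring
        _ ≤ _ := h1
        _ = _ := by field_simp; ring
    exact le_of_mul_le_mul_right h4 (by positivity)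
  · intro t ht
    have ht0 : (t : ℂ) ≠ 0 := Complex.ofReal_ne_zero.2 ht.1.ne'
    have ht' : HasDerivAt (fun t : ℝ => (t : ℂ)) 1 t := Complex.ofRealCLM.hasDerivAt
    refine (((ht'.pow 2).mul (hD t ht)).sub ((ht'.pow 4).const_mul _)).congr_deriv ?_
    have h1 := hD' t ht
    have h2 : circleCoeff 1 (fun z => g z / 2) c t = circleCoeff 1 g c t / 2 := by
      simp only [circleCoeff, ← intervalIntegral.integral_div]
      congr 1
      ext θ
      ring
    rw [h2] at h1
    have h3 : (t : ℂ) ^ 3 * (circleCoeff 1 g c t / t) = t ^ 2 * circleCoeff 1 g c t := by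
      field_simp
    rw [mul_sub, h3]
    push_cast at h1 ⊢
    simp only [Pi.pow_apply]
    linear_combination (t : ℂ) * h1
  · intro t ht
    rw [norm_mul, norm_pow, Complex.norm_of_nonneg ht.1.le, sub_self, Real.rpow_zero, mul_one]
    have ht0 := ht.1.le
    have ht1 := ht.2
    refine mul_le_mul (by gcongr) ((hG t ht).trans ?_) (norm_nonneg _) (by positivity)
    gcongr
  · have h1 := (hasDerivAt_circleCoeff hv hg2 hgbar (1 + 1)
        (t := 0) (by simpa using hR)).continuousAt
    have h2 : ContinuousAt (fun t : ℝ =>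
        (t : ℂ) ^ 2 * circleCoeff (1 + 1) v c t - Real.pi / 2 * p c * (t : ℂ) ^ 4) 0 := by
      fun_prop
    simpa using h2.tendsto.mono_left nhdsWithin_le_nhds

end Estimates

theorem norm_wirtingerCLM_le (p q : ℂ) : ‖wirtingerCLM p q‖ ≤ ‖p‖ + ‖q‖ := by
  refine ContinuousLinearMap.opNorm_le_bound _ (by positivity) fun h => ?_
  rw [wirtingerCLM_apply, add_mul]
  refine (norm_add_le _ _).trans ?_
  rw [norm_mul, norm_mul, Complex.norm_conj]

theorem norm_wirtingerCLM_half_conj_le (a : ℂ) :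
    ‖wirtingerCLM (a / 2) ((starRingEnd ℂ) a / 2)‖ ≤ ‖a‖ := by
  simpa only [norm_div, Complex.norm_conj, Complex.norm_two, add_halves] using
    norm_wirtingerCLM_le (a / 2) ((starRingEnd ℂ) a / 2)

theorem hasFDerivAt_log_norm {z : ℂ} (hz : z ≠ 0) :
    HasFDerivAt (fun w : ℂ => (Real.log ‖w‖ : ℂ))
      (wirtingerCLM (1 / z / 2) ((starRingEnd ℂ) (1 / z) / 2)) z := by
  have hz' : ‖z‖ ^ 2 ≠ 0 := by positivity
  have h1 := ((hasStrictFDerivAt_norm_sq z).hasFDerivAt.log hz').const_mul (1 / 2 : ℝ)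
  have h2 := Complex.ofRealCLM.hasFDerivAt.comp z h1
  refine (h2.congr_fderiv (ContinuousLinearMap.ext fun h => ?_)).congr_of_eventuallyEq
    (Eventually.of_forall fun w => by simp [Real.log_pow])
  have h3 : ((‖z‖ : ℂ)) ^ 2 = z * (starRingEnd ℂ) z := (Complex.mul_conj' z).symm
  have h4 : (starRingEnd ℂ) z ≠ 0 := by simpa using hz
  simp [h3]
  field_simp
  apply Complex.ext <;> simp <;> ring

theorem norm_rpow_le_of_mem_ball {c z : ℂ} (hc : c ≠ 0) (hz : z ∈ ball c (‖c‖ / 2)) (s : ℝ) :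
    ‖z‖ ^ s ≤ 2 ^ |s| * ‖c‖ ^ s := by
  have hc' : 0 < ‖c‖ := norm_pos_iff.2 hc
  rw [mem_ball, dist_eq_norm] at hz
  have h1 : ‖c‖ / 2 ≤ ‖z‖ := by
    have := norm_sub_norm_le c z
    rw [norm_sub_rev] at this
    linarith
  have h2 : ‖z‖ ≤ 2 * ‖c‖ := by
    have := norm_sub_norm_le z c
    linarith
  rcases le_total 0 s with hs | hs
  · rw [abs_of_nonneg hs, ← Real.mul_rpow two_pos.le hc'.le]
    exact Real.rpow_le_rpow (norm_nonneg _) h2 hs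
  · rw [abs_of_nonpos hs, Real.rpow_neg two_pos.le, ← Real.inv_rpow two_pos.le,
      ← Real.mul_rpow (by norm_num) hc'.le]
    refine Real.rpow_le_rpow_of_nonpos (by positivity) ?_ hs
    linarith

theorem tendsto_zero_of_norm_le_oscillation {r : ℂ → ℝ} {q : ℂ → ℂ} {A C s δ : ℝ}
    (hr : ContinuousAt r 0) (hA : 0 < A) (hs : 0 < s) (hδ : 0 < δ)
    (h : ∀ c : ℂ, c ≠ 0 → ‖c‖ < δ → ∀ B, (∀ z ∈ ball c (‖c‖ / 2), |r z - r 0| ≤ B) →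
      ‖q c‖ ≤ A * B + C * ‖c‖ ^ s) :
    Tendsto q (𝓝[≠] 0) (𝓝 0) := by
  rw [Metric.tendsto_nhds]
  intro ε hε
  obtain ⟨η, hη, hrη⟩ := Metric.continuousAt_iff.1 hr (ε / (2 * A)) (by positivity)
  have hlim : Tendsto (fun c : ℂ => C * ‖c‖ ^ s) (𝓝[≠] 0) (𝓝 0) := by
    have h1 : ContinuousAt (fun c : ℂ => C * ‖c‖ ^ s) 0 :=
      ((continuous_norm.continuousAt).rpow_const (Or.inr hs.le)).const_mul C
    have h2 := h1.tendsto.mono_left (nhdsWithin_le_nhds (s := {0}ᶜ))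
    simpa [Real.zero_rpow hs.ne'] using h2
  filter_upwards [hlim.eventually (gt_mem_nhds (half_pos hε)), self_mem_nhdsWithin,
    nhdsWithin_le_nhds (ball_mem_nhds 0 hδ),
    nhdsWithin_le_nhds (ball_mem_nhds 0 (half_pos hη))] with c h1 hc0 h2 h3
  rw [mem_ball_zero_iff] at h2 h3
  rw [dist_zero_right]
  refine (h c hc0 h2 (ε / (2 * A)) fun z hz => ?_).trans_lt ?_
  · refine (hrη ?_).le
    rw [mem_ball, dist_eq_norm] at hz
    rw [dist_zero_right]
    have := norm_sub_norm_le z c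
    linarith
  · have : A * (ε / (2 * A)) = ε / 2 := by field_simp
    linarith

theorem mem_punctured_of_mem_ball {c z : ℂ} {δ : ℝ} (hc : ‖c‖ < δ)
    (hz : z ∈ ball c (‖c‖ / 2)) : z ∈ ball (0 : ℂ) (2 * δ) \ {0} := by
  rw [mem_ball, dist_eq_norm] at hz
  constructor
  · rw [mem_ball_zero_iff]
    have := norm_sub_norm_le z c
    have := norm_nonneg c
    linarith
  · rintro rfl
    rw [zero_sub, norm_neg] at hz
    have := norm_nonneg c
    linarith

section ConicalSingularity

variable {r k : ℂ → ℝ} {g p : ℂ → ℂ} {γ δ M E : ℝ}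

theorem weight_le (hE : ∀ z ∈ ball (0 : ℂ) (2 * δ) \ {0}, Real.exp (2 * r z) ≤ E)
    {c z : ℂ} (hc : c ≠ 0) (hcδ : ‖c‖ < δ) (hz : z ∈ ball c (‖c‖ / 2)) :
    ‖z‖ ^ (2 * γ) * Real.exp (2 * r z) ≤ 2 ^ |2 * γ| * E * ‖c‖ ^ (2 * γ) := by
  calc _ ≤ (2 ^ |2 * γ| * ‖c‖ ^ (2 * γ)) * E :=
        mul_le_mul (norm_rpow_le_of_mem_ball hc hz _) (hE z (mem_punctured_of_mem_ball hcδ hz))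
          (Real.exp_pos _).le (by positivity)
    _ = _ := by ring

theorem norm_mul_wirtinger_le
    (hr : ∀ z ∈ ball (0 : ℂ) (2 * δ) \ {0}, HasFDerivAt (fun w => (r w : ℂ))
      (wirtingerCLM (g z / 2) ((starRingEnd ℂ) (g z) / 2)) z)
    (hg : ∀ z ∈ ball (0 : ℂ) (2 * δ) \ {0}, HasFDerivAt g (wirtingerCLM (p z)
      (((k z * (‖z‖ ^ (2 * γ) * Real.exp (2 * r z)) : ℝ) : ℂ) / 2)) z)
    (hp : ContinuousOn p (ball 0 (2 * δ) \ {0})) (hk : ContinuousOn k (ball 0 (2 * δ) \ {0}))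
    (hM : ∀ z ∈ ball (0 : ℂ) (2 * δ) \ {0}, |k z| ≤ M)
    (hE : ∀ z ∈ ball (0 : ℂ) (2 * δ) \ {0}, Real.exp (2 * r z) ≤ E)
    {c : ℂ} (hc : c ≠ 0) (hcδ : ‖c‖ < δ) {B : ℝ}
    (hB : ∀ z ∈ ball c (‖c‖ / 2), |r z - r 0| ≤ B) :
    ‖c * g c‖ ≤ 8 * B + M * (2 ^ |2 * γ| * E) / 2 * ‖c‖ ^ (2 * γ + 2) := by
  have hc' : 0 < ‖c‖ := norm_pos_iff.2 hc
  have hsub : ball c (‖c‖ / 2) ⊆ ball (0 : ℂ) (2 * δ) \ {0} :=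
    fun z hz => mem_punctured_of_mem_ball hcδ hz
  have hrc : ContinuousOn r (ball 0 (2 * δ) \ {0}) := fun z hz => by
    have := Complex.continuous_re.continuousAt.comp (hr z hz).continuousAt
    exact ContinuousAt.continuousWithinAt (by simpa [Function.comp_def] using this)
  have hfc : ContinuousOn (fun z : ℂ => ((k z * (‖z‖ ^ (2 * γ) * Real.exp (2 * r z)) : ℝ) : ℂ))
      (ball c (‖c‖ / 2)) := by
    refine Complex.continuous_ofReal.comp_continuousOn (ContinuousOn.mono ?_ hsub)
    refine hk.mul ((continuous_norm.continuousOn.rpow_const fun z hz =>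
      Or.inl (norm_ne_zero_iff.2 hz.2)).mul ((hrc.const_mul 2 ).rexp))
  have h := norm_wirtinger_le (v := fun w => (r w : ℂ) - r 0) (g := g) (p := p)
    (f := fun z => ((k z * (‖z‖ ^ (2 * γ) * Real.exp (2 * r z)) : ℝ) : ℂ))
    (c := c) (R := ‖c‖ / 2) (T := ‖c‖ / 4) (B := B)
    (F := M * (2 ^ |2 * γ| * E * ‖c‖ ^ (2 * γ)))
    (fun z hz => (hr z (hsub hz)).sub_const _) (fun z hz => hg z (hsub hz)) (hp.mono hsub) hfc
    (by positivity) (by linarith)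
    (fun z hz => by
      rw [← Complex.ofReal_sub, Complex.norm_real]
      exact hB z hz)
    (fun z hz => by
      have hw := weight_le (γ := γ) hE hc hcδ hz
      have hkz := hM z (hsub hz)
      have h0 : 0 ≤ ‖z‖ ^ (2 * γ) * Real.exp (2 * r z) := by positivity
      rw [Complex.norm_real, Real.norm_eq_abs, abs_mul, abs_of_nonneg h0]
      exact mul_le_mul hkz hw h0 ((abs_nonneg _).trans hkz))
  rw [norm_mul, Real.rpow_add hc', Real.rpow_two]
  calc _ ≤ ‖c‖ * _ := mul_le_mul_of_nonneg_left h hc'.le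
    _ = _ := by field_simp; ring

theorem norm_weight_sub_le {C : ℝ}
    (hr : ∀ z ∈ ball (0 : ℂ) (2 * δ) \ {0}, HasFDerivAt (fun w => (r w : ℂ))
      (wirtingerCLM (g z / 2) ((starRingEnd ℂ) (g z) / 2)) z)
    (hE : ∀ z ∈ ball (0 : ℂ) (2 * δ) \ {0}, Real.exp (2 * r z) ≤ E)
    (hC : ∀ z ∈ ball (0 : ℂ) (2 * δ) \ {0}, ‖z * g z‖ ≤ C)
    {c z : ℂ} (hc : c ≠ 0) (hcδ : ‖c‖ < δ) (hz : z ∈ ball c (‖c‖ / 2)) :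
    |‖z‖ ^ (2 * γ) * Real.exp (2 * r z) - ‖c‖ ^ (2 * γ) * Real.exp (2 * r c)| ≤
      4 * (|γ| + C) * (2 ^ |2 * γ| * E) * ‖c‖ ^ (2 * γ) / ‖c‖ * ‖z - c‖ := by
  have hc' : 0 < ‖c‖ := norm_pos_iff.2 hc
  have hsub : ball c (‖c‖ / 2) ⊆ ball (0 : ℂ) (2 * δ) \ {0} :=
    fun z hz => mem_punctured_of_mem_ball hcδ hz
  have hder : ∀ w ∈ ball c (‖c‖ / 2), HasFDerivAt
      (fun w : ℂ => Complex.exp (2 * (γ * (Real.log ‖w‖ : ℂ) + r w)))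
      (Complex.exp (2 * (γ * (Real.log ‖w‖ : ℂ) + r w)) • (2 : ℂ) •
        ((γ : ℂ) • wirtingerCLM (1 / w / 2) ((starRingEnd ℂ) (1 / w) / 2) +
          wirtingerCLM (g w / 2) ((starRingEnd ℂ) (g w) / 2))) w := fun w hw =>
    ((((hasFDerivAt_log_norm (hsub hw).2).const_mul (γ : ℂ)).add (hr w (hsub hw))).const_mul
      2).cexp
  have heq : ∀ w ∈ ball c (‖c‖ / 2), Complex.exp (2 * (γ * (Real.log ‖w‖ : ℂ) + r w)) =
      ((‖w‖ ^ (2 * γ) * Real.exp (2 * r w) : ℝ) : ℂ) := fun w hw => by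
    rw [Real.rpow_def_of_pos (norm_pos_iff.2 (hsub hw).2), ← Real.exp_add]
    push_cast
    ring_nf
  have hbound : ∀ w ∈ ball c (‖c‖ / 2),
      ‖Complex.exp (2 * (γ * (Real.log ‖w‖ : ℂ) + r w)) • (2 : ℂ) •
        ((γ : ℂ) • wirtingerCLM (1 / w / 2) ((starRingEnd ℂ) (1 / w) / 2) +
          wirtingerCLM (g w / 2) ((starRingEnd ℂ) (g w) / 2))‖ ≤
      4 * (|γ| + C) * (2 ^ |2 * γ| * E) * ‖c‖ ^ (2 * γ) / ‖c‖ := by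
    intro w hw
    have hw0 : 0 < ‖w‖ := norm_pos_iff.2 (hsub hw).2
    have hwc : ‖c‖ / 2 ≤ ‖w‖ := by
      rw [mem_ball, dist_eq_norm] at hw
      have := norm_sub_norm_le c w
      rw [norm_sub_rev] at this
      linarith
    have h1 := weight_le (γ := γ) hE hc hcδ hw
    have h0 : 0 ≤ ‖w‖ ^ (2 * γ) * Real.exp (2 * r w) := by positivity
    have hgw : ‖g w‖ ≤ C / ‖w‖ := by
      rw [le_div_iff₀ hw0, mul_comm, ← norm_mul]
      exact hC w (hsub hw)
    have h2 : ‖(γ : ℂ) • wirtingerCLM (1 / w / 2) ((starRingEnd ℂ) (1 / w) / 2) +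
          wirtingerCLM (g w / 2) ((starRingEnd ℂ) (g w) / 2)‖ ≤ (|γ| + C) / ‖w‖ := by
      have h3 := norm_wirtingerCLM_half_conj_le (1 / w)
      have h4 := norm_wirtingerCLM_half_conj_le (g w)
      rw [norm_div, norm_one] at h3
      refine (norm_add_le _ _).trans ?_
      rw [norm_smul, Complex.norm_real, Real.norm_eq_abs, add_div]
      refine add_le_add ?_ (h4.trans hgw)
      exact (mul_le_mul_of_nonneg_left h3 (abs_nonneg γ)).trans_eq (by ring)
    have hC0 : 0 ≤ |γ| + C := by
      have := (norm_nonneg _).trans (hC w (hsub hw))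
      positivity
    have h5 : (|γ| + C) / ‖w‖ ≤ (|γ| + C) / (‖c‖ / 2) := by gcongr
    rw [heq w hw, norm_smul, norm_smul, Complex.norm_two, Complex.norm_real,
      Real.norm_of_nonneg h0]
    calc _ ≤ (2 ^ |2 * γ| * E * ‖c‖ ^ (2 * γ)) * (2 * ((|γ| + C) / (‖c‖ / 2))) :=
          mul_le_mul h1 (by linarith) (by positivity) (h0.trans h1)
      _ = _ := by field_simp; ring
  have h := (convex_ball c (‖c‖ / 2)).norm_image_sub_le_of_norm_hasFDerivWithin_le
    (fun w hw => (hder w hw).hasFDerivWithinAt) hbound (mem_ball_self (half_pos hc')) hz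
  rwa [heq z hz, heq c (mem_ball_self (half_pos hc')), ← Complex.ofReal_sub, Complex.norm_real,
    Real.norm_eq_abs] at h

theorem norm_sq_mul_wirtinger_wirtinger_le {C K α : ℝ}
    (hr : ∀ z ∈ ball (0 : ℂ) (2 * δ) \ {0}, HasFDerivAt (fun w => (r w : ℂ))
      (wirtingerCLM (g z / 2) ((starRingEnd ℂ) (g z) / 2)) z)
    (hg : ∀ z ∈ ball (0 : ℂ) (2 * δ) \ {0}, HasFDerivAt g (wirtingerCLM (p z)
      (((k z * (‖z‖ ^ (2 * γ) * Real.exp (2 * r z)) : ℝ) : ℂ) / 2)) z)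
    (hp : ContinuousOn p (ball 0 (2 * δ) \ {0})) (hk : ContinuousOn k (ball 0 (2 * δ) \ {0}))
    (hM : ∀ z ∈ ball (0 : ℂ) (2 * δ) \ {0}, |k z| ≤ M)
    (hE : ∀ z ∈ ball (0 : ℂ) (2 * δ) \ {0}, Real.exp (2 * r z) ≤ E)
    (hC : ∀ z ∈ ball (0 : ℂ) (2 * δ) \ {0}, ‖z * g z‖ ≤ C) (hK0 : 0 ≤ K) (hα : 0 < α)
    (hα1 : α ≤ 1) (hK : ∀ z ∈ ball (0 : ℂ) (2 * δ) \ {0}, ∀ w ∈ ball (0 : ℂ) (2 * δ) \ {0},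
      |k z - k w| ≤ K * ‖z - w‖ ^ α)
    {c : ℂ} (hc : c ≠ 0) (hcδ : ‖c‖ < δ) (hc1 : ‖c‖ ≤ 1) {B : ℝ}
    (hB : ∀ z ∈ ball c (‖c‖ / 2), |r z - r 0| ≤ B) :
    ‖c ^ 2 * p c‖ ≤ 64 * B + 4 * ((4 * M * (|γ| + C) + K) * (2 ^ |2 * γ| * E)) / α *
      ‖c‖ ^ (2 * γ + 2) := by
  have hc' : 0 < ‖c‖ := norm_pos_iff.2 hc
  have hcc : c ∈ ball c (‖c‖ / 2) := mem_ball_self (half_pos hc')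
  have hsub : ball c (‖c‖ / 2) ⊆ ball (0 : ℂ) (2 * δ) \ {0} :=
    fun z hz => mem_punctured_of_mem_ball hcδ hz
  have hM0 : 0 ≤ M := (abs_nonneg _).trans (hM c (hsub hcc))
  have hE0 : 0 ≤ E := (Real.exp_pos _).le.trans (hE c (hsub hcc))
  have hC0 : 0 ≤ C := (norm_nonneg _).trans (hC c (hsub hcc))
  set N : ℝ := 2 ^ |2 * γ| * E with hN
  have hN0 : 0 ≤ N := by positivity
  have hrc : ContinuousOn r (ball 0 (2 * δ) \ {0}) := fun z hz => by
    have := Complex.continuous_re.continuousAt.comp (hr z hz).continuousAt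
    exact ContinuousAt.continuousWithinAt (by simpa [Function.comp_def] using this)
  have hfc : ContinuousOn (fun z : ℂ => ((k z * (‖z‖ ^ (2 * γ) * Real.exp (2 * r z)) : ℝ) : ℂ))
      (ball c (‖c‖ / 2)) := by
    refine Complex.continuous_ofReal.comp_continuousOn (ContinuousOn.mono ?_ hsub)
    refine hk.mul ((continuous_norm.continuousOn.rpow_const fun z hz =>
      Or.inl (norm_ne_zero_iff.2 hz.2)).mul ((hrc.const_mul 2 ).rexp))
  have hH : ∀ z ∈ ball c (‖c‖ / 2),
      ‖((k z * (‖z‖ ^ (2 * γ) * Real.exp (2 * r z)) : ℝ) : ℂ) -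
        ((k c * (‖c‖ ^ (2 * γ) * Real.exp (2 * r c)) : ℝ) : ℂ)‖ ≤
      ((4 * M * (|γ| + C) + K) * N * ‖c‖ ^ (2 * γ) / ‖c‖ ^ α) * ‖z - c‖ ^ α := by
    intro z hz
    have h1 := norm_weight_sub_le (γ := γ) hr hE hC hc hcδ hz
    have h2 := weight_le (γ := γ) hE hc hcδ hcc
    have h3 := hM z (hsub hz)
    have h4 := hK z (hsub hz) c (hsub hcc)
    have hcα : ‖c‖ ^ α ≤ 1 := Real.rpow_le_one hc'.le hc1 hα.le
    have hcα0 : 0 < ‖c‖ ^ α := Real.rpow_pos_of_pos hc' α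
    have h5 : ‖z - c‖ / ‖c‖ ≤ ‖z - c‖ ^ α / ‖c‖ ^ α := by
      rw [← Real.div_rpow (norm_nonneg _) hc'.le]
      refine Real.self_le_rpow_of_le_one (by positivity) ?_ hα1
      rw [mem_ball, dist_eq_norm] at hz
      rw [div_le_one hc']
      linarith
    have h6 : ‖z - c‖ ^ α ≤ ‖z - c‖ ^ α / ‖c‖ ^ α :=
      le_div_self (by positivity) hcα0 hcα
    rw [← Complex.ofReal_sub, Complex.norm_real, Real.norm_eq_abs]
    set X := ‖z‖ ^ (2 * γ) * Real.exp (2 * r z)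
    set Y := ‖c‖ ^ (2 * γ) * Real.exp (2 * r c) with hY
    have hY0 : 0 ≤ Y := by positivity
    calc |k z * X - k c * Y| = |k z * (X - Y) + (k z - k c) * Y| := by ring_nf
      _ ≤ |k z| * |X - Y| + |k z - k c| * Y := by
        refine (abs_add_le _ _).trans ?_
        rw [abs_mul, abs_mul, abs_of_nonneg hY0]
      _ ≤ M * (4 * (|γ| + C) * N * ‖c‖ ^ (2 * γ) / ‖c‖ * ‖z - c‖) +
          (K * ‖z - c‖ ^ α) * (N * ‖c‖ ^ (2 * γ)) := by gcongr
      _ = (M * (4 * (|γ| + C) * N * ‖c‖ ^ (2 * γ))) * (‖z - c‖ / ‖c‖) +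
          (K * (N * ‖c‖ ^ (2 * γ))) * ‖z - c‖ ^ α := by ring
      _ ≤ (M * (4 * (|γ| + C) * N * ‖c‖ ^ (2 * γ))) * (‖z - c‖ ^ α / ‖c‖ ^ α) +
          (K * (N * ‖c‖ ^ (2 * γ))) * (‖z - c‖ ^ α / ‖c‖ ^ α) := by gcongr
      _ = _ := by ring
  have h := norm_wirtinger_wirtinger_le (v := fun w => (r w : ℂ) - r 0) (g := g) (p := p)
    (f := fun z => ((k z * (‖z‖ ^ (2 * γ) * Real.exp (2 * r z)) : ℝ) : ℂ))
    (c := c) (R := ‖c‖ / 2) (T := ‖c‖ / 4) (B := B)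
    (fun z hz => (hr z (hsub hz)).sub_const _) (fun z hz => hg z (hsub hz)) (hp.mono hsub) hfc
    (by positivity) (by linarith) hα
    (fun z hz => by
      rw [← Complex.ofReal_sub, Complex.norm_real]
      exact hB z hz)
    (by positivity) hH
  have hα4 : (‖c‖ / 4) ^ α ≤ ‖c‖ ^ α :=
    Real.rpow_le_rpow (by positivity) (by linarith) hα.le
  have hcα0 : 0 < ‖c‖ ^ α := Real.rpow_pos_of_pos hc' α
  rw [norm_mul, norm_pow, Real.rpow_add hc', Real.rpow_two]
  calc _ ≤ ‖c‖ ^ 2 * _ := mul_le_mul_of_nonneg_left h (by positivity)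
    _ ≤ ‖c‖ ^ 2 * (4 * B / (‖c‖ / 4) ^ 2 + 4 * ((4 * M * (|γ| + C) + K) * N * ‖c‖ ^ (2 * γ) /
        ‖c‖ ^ α) * ‖c‖ ^ α / α) := by gcongr
    _ = _ := by field_simp; ring

theorem tendsto_mul_wirtinger (hγ : -1 < γ) (hδ : 0 < δ) (hr0 : ContinuousAt r 0)
    (hr : ∀ z ∈ ball (0 : ℂ) (2 * δ) \ {0}, HasFDerivAt (fun w => (r w : ℂ))
      (wirtingerCLM (g z / 2) ((starRingEnd ℂ) (g z) / 2)) z)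
    (hg : ∀ z ∈ ball (0 : ℂ) (2 * δ) \ {0}, HasFDerivAt g (wirtingerCLM (p z)
      (((k z * (‖z‖ ^ (2 * γ) * Real.exp (2 * r z)) : ℝ) : ℂ) / 2)) z)
    (hp : ContinuousOn p (ball 0 (2 * δ) \ {0})) (hk : ContinuousOn k (ball 0 (2 * δ) \ {0}))
    (hM : ∀ z ∈ ball (0 : ℂ) (2 * δ) \ {0}, |k z| ≤ M)
    (hE : ∀ z ∈ ball (0 : ℂ) (2 * δ) \ {0}, Real.exp (2 * r z) ≤ E) :
    Tendsto (fun z => z * g z) (𝓝[≠] 0) (𝓝 0) :=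
  tendsto_zero_of_norm_le_oscillation hr0 (by norm_num) (by linarith) hδ
    fun _ hc hcδ _ hB => norm_mul_wirtinger_le hr hg hp hk hM hE hc hcδ hB

theorem tendsto_sq_mul_wirtinger_wirtinger {C K α : ℝ} (hγ : -1 < γ) (hδ : 0 < δ) (hδ1 : δ ≤ 1)
    (hr0 : ContinuousAt r 0)
    (hr : ∀ z ∈ ball (0 : ℂ) (2 * δ) \ {0}, HasFDerivAt (fun w => (r w : ℂ))
      (wirtingerCLM (g z / 2) ((starRingEnd ℂ) (g z) / 2)) z)
    (hg : ∀ z ∈ ball (0 : ℂ) (2 * δ) \ {0}, HasFDerivAt g (wirtingerCLM (p z)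
      (((k z * (‖z‖ ^ (2 * γ) * Real.exp (2 * r z)) : ℝ) : ℂ) / 2)) z)
    (hp : ContinuousOn p (ball 0 (2 * δ) \ {0})) (hk : ContinuousOn k (ball 0 (2 * δ) \ {0}))
    (hM : ∀ z ∈ ball (0 : ℂ) (2 * δ) \ {0}, |k z| ≤ M)
    (hE : ∀ z ∈ ball (0 : ℂ) (2 * δ) \ {0}, Real.exp (2 * r z) ≤ E)
    (hC : ∀ z ∈ ball (0 : ℂ) (2 * δ) \ {0}, ‖z * g z‖ ≤ C) (hK0 : 0 ≤ K) (hα : 0 < α)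
    (hα1 : α ≤ 1) (hK : ∀ z ∈ ball (0 : ℂ) (2 * δ) \ {0}, ∀ w ∈ ball (0 : ℂ) (2 * δ) \ {0},
      |k z - k w| ≤ K * ‖z - w‖ ^ α) :
    Tendsto (fun z => z ^ 2 * p z) (𝓝[≠] 0) (𝓝 0) :=
  tendsto_zero_of_norm_le_oscillation hr0 (by norm_num) (by linarith) hδ
    fun _ hc hcδ _ hB => norm_sq_mul_wirtinger_wirtinger_le hr hg hp hk hM hE hC hK0 hα hα1 hK
      hc hcδ (hcδ.le.trans hδ1) hB

end ConicalSingularity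

theorem eq_wirtingerCLM (L : ℂ →L[ℝ] ℂ) :
    L = wirtingerCLM ((L 1 - Complex.I * L Complex.I) / 2)
      ((L 1 + Complex.I * L Complex.I) / 2) := by
  refine ContinuousLinearMap.ext fun h => ?_
  have h1 : h = h.re • (1 : ℂ) + h.im • Complex.I := by simp [Complex.re_add_im]
  have h2 : L h = h.re * L 1 + h.im * L Complex.I := by
    conv_lhs => rw [h1]
    rw [map_add, map_smul, map_smul, Complex.real_smul, Complex.real_smul]
  have h3 : (starRingEnd ℂ) h = h.re - h.im * Complex.I := by
    apply Complex.ext <;> simp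
  have h4 : h = h.re + h.im * Complex.I := (Complex.re_add_im h).symm
  rw [wirtingerCLM_apply, h2, h3]
  nth_rewrite 3 [h4]
  linear_combination (h.im * L Complex.I) * Complex.I_sq

theorem hasFDerivAt_ofReal_wirtR {u : ℂ → ℝ} {z : ℂ} (hu : DifferentiableAt ℝ u z) :
    HasFDerivAt (fun w => (u w : ℂ))
      (wirtingerCLM (2 * wirtR u z / 2) ((starRingEnd ℂ) (2 * wirtR u z) / 2)) z := by
  refine (Complex.ofRealCLM.hasFDerivAt.comp z hu.hasFDerivAt).congr_fderiv ?_
  rw [eq_wirtingerCLM (Complex.ofRealCLM ∘SL fderiv ℝ u z)]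
  have h2 : (starRingEnd ℂ) 2 = 2 := map_ofNat _ 2
  congr 1 <;> simp [wirtR, h2]

theorem contDiffOn_two_mul_wirtR {u : ℂ → ℝ} {s : Set ℂ} (hs : IsOpen s)
    (hu : ContDiffOn ℝ 2 u s) : ContDiffOn ℝ 1 (fun z => 2 * wirtR u z) s := by
  have h := hu.fderiv_of_isOpen hs (m := 1) (by norm_num)
  have h1 (a : ℂ) : ContDiffOn ℝ 1 (fun z => ((fderiv ℝ u z a : ℝ) : ℂ)) s :=
    Complex.ofRealCLM.contDiff.comp_contDiffOn (h.clm_apply contDiffOn_const)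
  have h2 : ContDiffOn ℝ 1 (fun z => 2 * (((fderiv ℝ u z 1 : ℝ) : ℂ) -
      Complex.I * ((fderiv ℝ u z Complex.I : ℝ) : ℂ)) * (1 / 2)) s :=
    (contDiffOn_const.mul ((h1 1).sub (contDiffOn_const.mul (h1 Complex.I)))).mul
      contDiffOn_const
  refine h2.congr fun z _ => ?_
  simp only [wirtR]
  ring

theorem hasFDerivAt_two_mul_wirtR {u : ℂ → ℝ} {s : Set ℂ} (hs : IsOpen s)
    (hu : ContDiffOn ℝ 2 u s) {z : ℂ} (hz : z ∈ s) :
    HasFDerivAt (fun z => 2 * wirtR u z)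
      (wirtingerCLM (wirtC (fun z => 2 * wirtR u z) z) ((lapl u z : ℂ) / 2)) z := by
  have hd : DifferentiableAt ℝ (fun z => 2 * wirtR u z) z :=
    ((contDiffOn_two_mul_wirtR hs hu).contDiffAt (hs.mem_nhds hz)).differentiableAt (by norm_num)
  refine hd.hasFDerivAt.congr_fderiv ?_
  have huz : ContDiffAt ℝ 2 u z := hu.contDiffAt (hs.mem_nhds hz)
  have hsymm : IsSymmSndFDerivAt ℝ u z := huz.isSymmSndFDerivAt (by simp)
  have hd2 : DifferentiableAt ℝ (fderiv ℝ u) z :=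
    (huz.fderiv_right (m := 1) (by norm_num)).differentiableAt (by norm_num)
  have hda (a : ℂ) : HasFDerivAt (fun w => ((fderiv ℝ u w a : ℝ) : ℂ))
      (Complex.ofRealCLM ∘SL (fderiv ℝ (fderiv ℝ u) z).flip a) z := by
    have h := (ContinuousLinearMap.apply ℝ ℝ a).hasFDerivAt.comp z hd2.hasFDerivAt
    exact Complex.ofRealCLM.hasFDerivAt.comp z h
  have hg : HasFDerivAt (fun z => 2 * wirtR u z)
      (Complex.ofRealCLM ∘SL (fderiv ℝ (fderiv ℝ u) z).flip 1 - Complex.I •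
        (Complex.ofRealCLM ∘SL (fderiv ℝ (fderiv ℝ u) z).flip Complex.I)) z := by
    refine ((hda 1).sub ((hda Complex.I).const_mul Complex.I)).congr_of_eventuallyEq
      (Eventually.of_forall fun w => ?_)
    simp only [wirtR, Pi.sub_apply]
    ring
  have hfa (a b : ℂ) : fderiv ℝ (fun w => fderiv ℝ u w a) z b = fderiv ℝ (fderiv ℝ u) z b a := by
    have h : HasFDerivAt (fun w => fderiv ℝ u w a)
        (ContinuousLinearMap.apply ℝ ℝ a ∘SL fderiv ℝ (fderiv ℝ u) z) z :=
      (ContinuousLinearMap.apply ℝ ℝ a).hasFDerivAt.comp z hd2.hasFDerivAt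
    rw [h.fderiv]
    rfl
  rw [eq_wirtingerCLM (fderiv ℝ (fun z => 2 * wirtR u z) z)]
  congr 1
  rw [hg.fderiv, lapl, hfa, hfa]
  have hs1 := hsymm.eq 1 Complex.I
  simp [hs1]
  linear_combination -(fderiv ℝ (fderiv ℝ u) z Complex.I Complex.I : ℂ) * Complex.I_sq

theorem continuousOn_wirtC {f : ℂ → ℂ} {s : Set ℂ} (hs : IsOpen s) (hf : ContDiffOn ℝ 1 f s) :
    ContinuousOn (wirtC f) s := by
  have h := hf.continuousOn_fderiv_of_isOpen hs le_rfl
  exact ((h.clm_apply continuousOn_const).sub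
    (continuousOn_const.mul (h.clm_apply continuousOn_const))).div_const 2

/-- Corollary 1.2 (b): if λ(z)|dz| is a conformal metric on 𝔻∖{0} with curvature −k(z)
for a bounded nonpositive continuous k which extends locally Hölder continuously to 𝔻,
∬_𝔻 λ² dxdy < ∞, and conical singularity of order γ > −1 at 0, then
z²·S_λ(z) → −γ(2+γ)/2 as z → 0. -/
theorem schwarzian_limit (k lam : ℂ → ℝ) (γ : ℝ) (r : ℂ → ℝ)
    (hk_cont : ContinuousOn k (ball (0 : ℂ) 1 \ {0}))
    (hk_bdd : ∃ M : ℝ, ∀ z ∈ ball (0 : ℂ) 1 \ {0}, |k z| ≤ M)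
    (hk_nonpos : ∀ z ∈ ball (0 : ℂ) 1 \ {0}, k z ≤ 0)
    (hk_holder : ∃ K : ℂ → ℝ, (∀ z ∈ ball (0 : ℂ) 1 \ {0}, K z = k z) ∧
      ∀ z ∈ ball (0 : ℂ) 1, ∃ s ∈ nhds z, ∃ (C α : ℝ≥0),
        0 < α ∧ α ≤ 1 ∧ HolderOnWith C α K s)
    (hlam_pos : ∀ z ∈ ball (0 : ℂ) 1 \ {0}, 0 < lam z)
    (hlam : ContDiffOn ℝ 2 lam (ball (0 : ℂ) 1 \ {0}))
    (hcurv : ∀ z ∈ ball (0 : ℂ) 1 \ {0},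
      lapl (fun w => Real.log (lam w)) z = k z * lam z ^ 2)
    (hint : ∫⁻ z in ball (0 : ℂ) 1, ENNReal.ofReal (lam z ^ 2) < ⊤)
    (hγ : -1 < γ)
    (hr_cont : ContinuousOn r (ball (0 : ℂ) 1))
    (hdecomp : ∀ z ∈ ball (0 : ℂ) 1 \ {0},
      Real.log (lam z) = γ * Real.log ‖z‖ + r z) :
    Tendsto (fun z => z ^ 2 * schw lam z) (𝓝[≠] (0 : ℂ))
      (𝓝 (-((γ : ℂ) * (2 + (γ : ℂ))) / 2)) := by
  have hs : IsOpen (ball (0 : ℂ) 1 \ {0}) := isOpen_ball.sdiff isClosed_singleton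
  have hu : ContDiffOn ℝ 2 (fun w => Real.log (lam w)) (ball (0 : ℂ) 1 \ {0}) :=
    hlam.log fun z hz => (hlam_pos z hz).ne'
  have hr0 : ContinuousAt r 0 := hr_cont.continuousAt (ball_mem_nhds 0 one_pos)
  have hconn : ContDiffOn ℝ 1 (conn lam) (ball (0 : ℂ) 1 \ {0}) :=
    contDiffOn_two_mul_wirtR hs hu
  set g : ℂ → ℂ := fun z => conn lam z - γ * (1 / z) with hg_def
  set p : ℂ → ℂ := fun z => wirtC (conn lam) z + γ / z ^ 2 with hp_def
  have hr : ∀ z ∈ ball (0 : ℂ) 1 \ {0}, HasFDerivAt (fun w => (r w : ℂ))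
      (wirtingerCLM (g z / 2) ((starRingEnd ℂ) (g z) / 2)) z := by
    intro z hz
    have h1 := hasFDerivAt_ofReal_wirtR
      ((hu.contDiffAt (hs.mem_nhds hz)).differentiableAt (by norm_num))
    have h2 := (hasFDerivAt_log_norm hz.2).const_mul (γ : ℂ)
    refine ((h1.sub h2).congr_fderiv ?_).congr_of_eventuallyEq ?_
    · refine ContinuousLinearMap.ext fun h => ?_
      simp [hg_def, conn]
      ring
    · filter_upwards [hs.mem_nhds hz] with w hw
      simp [hdecomp w hw]
  have hg : ∀ z ∈ ball (0 : ℂ) 1 \ {0}, HasFDerivAt g (wirtingerCLM (p z)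
      (((k z * (‖z‖ ^ (2 * γ) * Real.exp (2 * r z)) : ℝ) : ℂ) / 2)) z := by
    intro z hz
    have hz0 : z ≠ 0 := hz.2
    have h1 : HasFDerivAt (conn lam) _ z := hasFDerivAt_two_mul_wirtR hs hu hz
    have h2 := (((hasDerivAt_inv hz0).const_mul (γ : ℂ)).hasFDerivAt.restrictScalars ℝ)
    refine ((h1.sub h2).congr_fderiv ?_).congr_of_eventuallyEq
      (Eventually.of_forall fun w => by simp [hg_def])
    have hweight : ‖z‖ ^ (2 * γ) * Real.exp (2 * r z) = lam z ^ 2 := by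
      rw [← Real.exp_log (pow_pos (hlam_pos z hz) 2), Real.log_pow, hdecomp z hz,
        Real.rpow_def_of_pos (norm_pos_iff.2 hz0), ← Real.exp_add]
      push_cast
      ring_nf
    rw [hweight, hcurv z hz]
    refine ContinuousLinearMap.ext fun h => ?_
    simp [hp_def]
    change wirtC (conn lam) z * h + _ + _ = _
    ring
  have hp : ContinuousOn p (ball (0 : ℂ) 1 \ {0}) :=
    (continuousOn_wirtC hs hconn).add (continuousOn_const.div (continuousOn_pow 2)
      fun z hz => pow_ne_zero 2 hz.2)
  obtain ⟨M, hM⟩ := hk_bdd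
  obtain ⟨K, hKk, hK⟩ := hk_holder
  obtain ⟨s, hs0, CK, α, hα, hα1, hKs⟩ := hK 0 (mem_ball_self one_pos)
  obtain ⟨δ₁, hδ₁, hrδ₁⟩ := Metric.continuousAt_iff.1 hr0 1 one_pos
  obtain ⟨δ₂, hδ₂, hsδ₂⟩ := Metric.mem_nhds_iff.1 hs0
  have hE : ∀ z, ‖z‖ < δ₁ → Real.exp (2 * r z) ≤ Real.exp (2 * (r 0 + 1)) := fun z hz => by
    have := hrδ₁ (x := z) (by simpa using hz)
    rw [Real.dist_eq, abs_lt] at this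
    exact Real.exp_le_exp.2 (by linarith)
  have hsub {δ ε : ℝ} (h : δ ≤ ε) : ball (0 : ℂ) δ \ {0} ⊆ ball 0 ε \ {0} :=
    Set.sdiff_subset_sdiff_left (ball_subset_ball h)
  have hzg : Tendsto (fun z => z * g z) (𝓝[≠] 0) (𝓝 0) := by
    have h1 : 2 * (min 1 δ₁ / 2) ≤ 1 := by linarith [min_le_left 1 δ₁]
    have h2 : 2 * (min 1 δ₁ / 2) ≤ δ₁ := by linarith [min_le_right 1 δ₁]
    exact tendsto_mul_wirtinger hγ (half_pos (lt_min one_pos hδ₁)) hr0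
      (fun z hz => hr z (hsub h1 hz)) (fun z hz => hg z (hsub h1 hz)) (hp.mono (hsub h1))
      (hk_cont.mono (hsub h1)) (fun z hz => hM z (hsub h1 hz))
      fun z hz => hE z (mem_ball_zero_iff.1 (hsub h2 hz).1)
  obtain ⟨δ₃, hδ₃, hgδ₃⟩ : ∃ δ₃ > 0, ∀ z ∈ ball (0 : ℂ) δ₃ \ {0}, ‖z * g z‖ ≤ 1 := by
    have h := hzg.norm.eventually (gt_mem_nhds (by simp : ‖(0 : ℂ)‖ < 1))
    obtain ⟨δ₃, hδ₃, h⟩ := Metric.mem_nhdsWithin_iff.1 h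
    exact ⟨δ₃, hδ₃, fun z hz => (h ⟨hz.1, hz.2⟩).le⟩
  have hzp : Tendsto (fun z => z ^ 2 * p z) (𝓝[≠] 0) (𝓝 0) := by
    obtain ⟨δ, hδ, h1, h2, h3, h4⟩ : ∃ δ > 0, 2 * δ ≤ 1 ∧ 2 * δ ≤ δ₁ ∧ 2 * δ ≤ δ₂ ∧ 2 * δ ≤ δ₃ := by
      refine ⟨min (min 1 δ₁) (min δ₂ δ₃) / 2, by positivity, ?_, ?_, ?_, ?_⟩ <;>
        rw [mul_div_cancel₀ _ two_ne_zero] <;> simp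
    refine tendsto_sq_mul_wirtinger_wirtinger hγ hδ (by linarith) hr0
      (fun z hz => hr z (hsub h1 hz)) (fun z hz => hg z (hsub h1 hz)) (hp.mono (hsub h1))
      (hk_cont.mono (hsub h1)) (fun z hz => hM z (hsub h1 hz))
      (fun z hz => hE z (mem_ball_zero_iff.1 (hsub h2 hz).1)) (fun z hz => hgδ₃ z (hsub h4 hz))
      CK.coe_nonneg (α := α) hα (by exact_mod_cast hα1) fun z hz w hw => ?_
    rw [← hKk z (hsub h1 hz), ← hKk w (hsub h1 hw), ← Real.dist_eq, ← dist_eq_norm]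
    exact hKs.dist_le (hsδ₂ (hsub h3 hz).1) (hsδ₂ (hsub h3 hw).1)
  have hlim := ((hzp.sub_const (γ + γ ^ 2 / 2 : ℂ)).sub (hzg.const_mul (γ : ℂ))).sub
    ((hzg.pow 2).div_const 2)
  have hval : (0 : ℂ) - (γ + γ ^ 2 / 2 : ℂ) - γ * 0 - 0 ^ 2 / 2 =
      -((γ : ℂ) * (2 + (γ : ℂ))) / 2 := by ring
  rw [hval] at hlim
  refine hlim.congr' ?_
  filter_upwards [self_mem_nhdsWithin] with z hz
  have hz0 : z ≠ 0 := hz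
  simp only [hp_def, hg_def, schw]
  field_simp
  ring
end

section
/- Let w be a real-valued harmonic function on the punctured unit disk 𝔻∖{0}. Then there exist a real constant γ and a holomorphic function g : 𝔻∖{0} → ℂ such that w(z) = γ·log|z| + Re g(z) for all z ∈ 𝔻∖{0}. -/
open Metric MeasureTheory

lemma harmonicOnNhd_of_lapl_eq_zero {w : ℂ → ℝ} {s : Set ℂ} (hs : IsOpen s)
    (hw : ContDiffOn ℝ 2 w s) (hharm : ∀ z ∈ s, lapl w z = 0) :
    InnerProductSpace.HarmonicOnNhd w s := by
  have hsec : ∀ z ∈ s, ∀ v : ℂ,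
      fderiv ℝ (fun y => fderiv ℝ w y v) z v = fderiv ℝ (fderiv ℝ w) z v v := by
    intro z hz v
    have hd : DifferentiableAt ℝ (fderiv ℝ w) z :=
      (((hw.contDiffAt (hs.mem_nhds hz)).fderiv_right (m := 1) (by norm_num)).differentiableAt
        one_ne_zero)
    rw [fderiv_clm_apply hd (by fun_prop)]
    simp
  intro x hx
  refine ⟨hw.contDiffAt (hs.mem_nhds hx), ?_⟩
  filter_upwards [hs.mem_nhds hx] with z hz
  have h := hharm z hz
  rw [lapl, hsec z hz, hsec z hz] at h
  simpa [InnerProductSpace.laplacian_eq_iteratedFDeriv_complexPlane, iteratedFDeriv_two_apply]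
    using h

lemma exp_mem_punctured_ball {ζ : ℂ} (hζ : ζ.re < 0) :
    Complex.exp ζ ∈ ball (0 : ℂ) 1 \ {0} := by
  simp [Complex.norm_exp, hζ]

lemma log_re_neg_of_mem_punctured_ball {z : ℂ} (hz : z ∈ ball (0 : ℂ) 1 \ {0}) :
    (Complex.log z).re < 0 := by
  rw [Complex.log_re]
  exact Real.log_neg (norm_pos_iff.2 hz.2) (by simpa using hz.1)

lemma convex_re_neg : Convex ℝ {ζ : ℂ | ζ.re < 0} := convex_halfSpace_re_lt 0

lemma isOpen_re_neg : IsOpen {ζ : ℂ | ζ.re < 0} :=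
  isOpen_lt Complex.continuous_re continuous_const

/-- A `2πi`-periodic holomorphic function on the left half-plane factors through `exp`. -/
lemma exists_differentiableOn_comp_exp_eq {G : ℂ → ℂ}
    (hG : DifferentiableOn ℂ G {ζ : ℂ | ζ.re < 0})
    (hper : ∀ ζ : ℂ, ζ.re < 0 → G (ζ + 2 * Real.pi * Complex.I) = G ζ) :
    ∃ g : ℂ → ℂ, DifferentiableOn ℂ g (ball (0 : ℂ) 1 \ {0}) ∧
      ∀ ζ : ℂ, ζ.re < 0 → g (Complex.exp ζ) = G ζ := by
  have hper' : Function.Periodic ({ζ : ℂ | ζ.re < 0}.indicator G) (2 * Real.pi * Complex.I) := by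
    intro ζ
    by_cases hζ : ζ.re < 0
    · simp [Set.indicator, hζ, hper ζ hζ]
    · simp [Set.indicator, hζ]
  have hfac : ∀ ζ : ℂ, ζ.re < 0 → G (Complex.log (Complex.exp ζ)) = G ζ := by
    intro ζ hζ
    have hlog := log_re_neg_of_mem_punctured_ball (exp_mem_punctured_ball hζ)
    obtain ⟨n, hn⟩ := Complex.exp_eq_exp_iff_exists_int.1
      (Complex.exp_log (Complex.exp_ne_zero ζ))
    have h := hper'.int_mul n ζ
    rw [← hn] at h
    rwa [Set.indicator_of_mem (show _ ∈ {ζ : ℂ | ζ.re < 0} from hlog),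
      Set.indicator_of_mem (show _ ∈ {ζ : ℂ | ζ.re < 0} from hζ)] at h
  refine ⟨fun z => G (Complex.log z), fun z hz => ?_, hfac⟩
  have hz0 : z ≠ 0 := hz.2
  set L : ℂ → ℂ := fun y => Complex.log (y / z) + Complex.log z
  have hLz : L z = Complex.log z := by simp [L, hz0]
  have hL : DifferentiableAt ℂ L z :=
    ((differentiableAt_id.div_const z).clog (by simp [hz0])).add_const _
  have hmem : {ζ : ℂ | ζ.re < 0} ∈ nhds (L z) :=
    isOpen_re_neg.mem_nhds (hLz ▸ log_re_neg_of_mem_punctured_ball hz)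
  have hGL : DifferentiableAt ℂ (fun y => G (L y)) z :=
    DifferentiableAt.comp z (hG.differentiableAt hmem) hL
  refine (hGL.congr_of_eventuallyEq ?_).differentiableWithinAt
  have hneg : ∀ᶠ y in nhds z, L y ∈ {ζ : ℂ | ζ.re < 0} :=
    hL.continuousAt.eventually_mem hmem
  filter_upwards [hneg, isOpen_ne.mem_nhds hz0] with y hy hy0
  have hexp : Complex.exp (L y) = y := by
    rw [Complex.exp_add, Complex.exp_log (div_ne_zero hy0 hz0), Complex.exp_log hz0,
      div_mul_cancel₀ _ hz0]
  rw [← hfac _ hy, hexp]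

/-- Pulled back to the left half-plane by `exp`, a harmonic function on the punctured disk is the
real part of a holomorphic function whose derivative is `2πi`-periodic. -/
lemma exists_hasDerivAt_re_eq_comp_exp {w : ℂ → ℝ}
    (hw : InnerProductSpace.HarmonicOnNhd w (ball (0 : ℂ) 1 \ {0})) :
    ∃ F h : ℂ → ℂ, (∀ ζ : ℂ, ζ.re < 0 → HasDerivAt F (h ζ) ζ) ∧
      (∀ ζ, h (ζ + 2 * Real.pi * Complex.I) = h ζ) ∧
      ∀ ζ : ℂ, ζ.re < 0 → (F ζ).re = w (Complex.exp ζ) := by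
  set f : ℂ → ℂ := fun z => fderiv ℝ w z 1 - Complex.I * fderiv ℝ w z Complex.I
  set h : ℂ → ℂ := fun ζ => f (Complex.exp ζ) * Complex.exp ζ
  have hh : DifferentiableOn ℂ h {ζ : ℂ | ζ.re < 0} := fun ζ hζ =>
    (((HarmonicAt.differentiableAt_complex_partial (hw _ (exp_mem_punctured_ball hζ))).comp ζ
      Complex.differentiable_exp.differentiableAt).mul
      Complex.differentiable_exp.differentiableAt).differentiableWithinAt
  obtain ⟨F, hF'⟩ := convex_re_neg.exists_forall_hasDerivWithinAt hh
  have hF : ∀ ζ : ℂ, ζ.re < 0 → HasDerivAt F (h ζ) ζ := fun ζ hζ =>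
    (hF' ζ hζ).hasDerivAt (isOpen_re_neg.mem_nhds hζ)
  have hzero : ∀ ζ : ℂ, ζ.re < 0 →
      HasFDerivAt (fun ζ => (F ζ).re - w (Complex.exp ζ)) (0 : ℂ →L[ℝ] ℝ) ζ := by
    intro ζ hζ
    have h1 := Complex.reCLM.hasFDerivAt.comp ζ ((hF ζ hζ).hasFDerivAt.restrictScalars ℝ)
    have h2 := ((hw _ (exp_mem_punctured_ball hζ)).1.differentiableAt
      two_ne_zero).hasFDerivAt.comp ζ ((Complex.hasDerivAt_exp ζ).hasFDerivAt.restrictScalars ℝ)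
    refine (h1.sub h2).congr_fderiv ?_
    ext v
    have hdec : ∀ a : ℂ, fderiv ℝ w (Complex.exp ζ) a =
        a.re * fderiv ℝ w (Complex.exp ζ) 1 + a.im * fderiv ℝ w (Complex.exp ζ) Complex.I := by
      intro a
      nth_rw 1 [(by simp : a = a.re • (1 : ℂ) + a.im • Complex.I)]
      rw [map_add, map_smul, map_smul, smul_eq_mul, smul_eq_mul]
    have := hdec (v * Complex.exp ζ)
    simp [h, f, this]
    ring
  have hconst : ∀ ζ : ℂ, ζ.re < 0 →
      (F ζ).re - w (Complex.exp ζ) = (F (-1)).re - w (Complex.exp (-1)) := by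
    intro ζ hζ
    exact isOpen_re_neg.is_const_of_fderiv_eq_zero (𝕜 := ℝ) convex_re_neg.isPreconnected
      (fun y hy => (hzero y hy).differentiableAt.differentiableWithinAt)
      (fun y hy => (hzero y hy).fderiv) hζ (by simp)
  refine ⟨fun ζ => F ζ - ((F (-1)).re - w (Complex.exp (-1)) : ℝ), h,
    fun ζ hζ => (hF ζ hζ).sub_const _, fun ζ => ?_, fun ζ hζ => ?_⟩
  · simp only [h, Complex.exp_periodic ζ]
  · rw [Complex.sub_re, Complex.ofReal_re]
    linarith [hconst ζ hζ]

/-- Every real-valued harmonic function on the punctured unit disk has the form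
w(z) = γ·log|z| + Re g(z) with γ ∈ ℝ and g holomorphic on 𝔻∖{0}. -/
theorem harmonic_on_punctured_disk_representation (w : ℂ → ℝ)
    (hw : ContDiffOn ℝ 2 w (ball (0 : ℂ) 1 \ {0}))
    (hharm : ∀ z ∈ ball (0 : ℂ) 1 \ {0}, lapl w z = 0) :
    ∃ (γ : ℝ) (g : ℂ → ℂ), DifferentiableOn ℂ g (ball (0 : ℂ) 1 \ {0}) ∧
      ∀ z ∈ ball (0 : ℂ) 1 \ {0}, w z = γ * Real.log ‖z‖ + (g z).re := by
  obtain ⟨F, h, hF, hper, hre⟩ := exists_hasDerivAt_re_eq_comp_exp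
    (harmonicOnNhd_of_lapl_eq_zero (isOpen_ball.sdiff isClosed_singleton) hw hharm)
  have hshift : ∀ ζ : ℂ, (ζ + 2 * Real.pi * Complex.I).re = ζ.re := by intro ζ; simp
  set c : ℂ := F (-1 + 2 * Real.pi * Complex.I) - F (-1)
  have hdiff : ∀ ζ : ℂ, ζ.re < 0 →
      HasDerivAt (fun ζ => F (ζ + 2 * Real.pi * Complex.I) - F ζ) 0 ζ := by
    intro ζ hζ
    have h1 := (hF _ ((hshift ζ).trans_lt hζ)).comp_add_const ζ (2 * Real.pi * Complex.I)
    exact (h1.sub (hF ζ hζ)).congr_deriv (by rw [hper, sub_self])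
  have hc : ∀ ζ : ℂ, ζ.re < 0 → F (ζ + 2 * Real.pi * Complex.I) - F ζ = c := fun ζ hζ =>
    isOpen_re_neg.is_const_of_deriv_eq_zero convex_re_neg.isPreconnected
      (fun y hy => (hdiff y hy).differentiableAt.differentiableWithinAt)
      (fun y hy => (hdiff y hy).deriv) hζ (by simp)
  have hcre : c.re = 0 := by
    have h1 : (-1 : ℂ).re < 0 := by simp
    simp only [c, Complex.sub_re]
    rw [hre _ h1, hre _ ((hshift _).trans_lt h1), Complex.exp_periodic, sub_self]
  set γ : ℝ := c.im / (2 * Real.pi)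
  have hγ : γ * (2 * Real.pi * Complex.I) = c := by
    have : (Real.pi : ℂ) ≠ 0 := by exact_mod_cast Real.pi_ne_zero
    have hcim : c = c.im * Complex.I := by
      apply Complex.ext <;> simp [hcre]
    rw [hcim]
    simp only [γ]
    push_cast
    field_simp
  obtain ⟨g, hg, hgexp⟩ := exists_differentiableOn_comp_exp_eq (G := fun ζ => F ζ - γ * ζ)
    (fun ζ hζ => ((hF ζ hζ).differentiableAt.sub
      (differentiableAt_id.const_mul _)).differentiableWithinAt)
    (fun ζ hζ => by linear_combination hc ζ hζ - hγ)
  refine ⟨γ, g, hg, fun z hz => ?_⟩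
  have hlog := log_re_neg_of_mem_punctured_ball hz
  have h1 := hgexp _ hlog
  have h2 := hre _ hlog
  rw [Complex.exp_log hz.2] at h1 h2
  rw [h1, Complex.sub_re, h2, Complex.re_ofReal_mul, Complex.log_re]
  ring
end
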